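/- arXiv:1407.7590 — 2 statements merged into one kernel-verified Lean document; each statement's English description precedes it below -/
import Mathlib

section
/- Outer bound (Theorem 1): For the deterministic two-hop interference channel with parameters (n, m, f, n̄, m̄), the sum capacity C_sum satisfies: if 3m ≤ 2n then C_sum ≤ min{2·max(n−m, m) + 2·max(n̄, m̄), 2n − m, 2f}; if 2n ≤ 3m and m ≤ 2n then C_sum ≤ min{max(2n−m, m), 2f}; and if m ≥ 2n then C_sum ≤ min{n + f + (n̄ − f)⁺, 2n + 2n̄, m, 2f}. -/
open scoped Classical

namespace TwoHopIC

/-- The `q × q` lower-shift matrix `S^k` over `F₂`, with `(S^k)_{i,j} = 1` iff `i = j + k`. -/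
def shiftMat (q k : ℕ) : Matrix (Fin q) (Fin q) (ZMod 2) :=
  Matrix.of fun i j => if (i : ℕ) = (j : ℕ) + k then 1 else 0

/-- Forward (first-hop) signal alphabet: vectors in `F₂^q` with `q = max m n`. -/
abbrev FSig (n m : ℕ) := Fin (max m n) → ZMod 2

/-- Backward/second-hop signal alphabet: vectors in `F₂^q̄` with `q̄ = max(m̄, n̄, f)`. -/
abbrev BSig (f nb mb : ℕ) := Fin (max mb (max nb f)) → ZMod 2

/-- A blocklength-`N` code with message sets of sizes `M1`, `M2`:
causal encoders at the sources (using the messages and the overheard signals),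
causal encoders at the relays (using their received signals), and decoders at the
destinations (using the `N` received signals). -/
structure Code (n m f nb mb N M1 M2 : ℕ) where
  encS1 : (t : ℕ) → Fin M1 → (Fin t → BSig f nb mb) → FSig n m
  encS2 : (t : ℕ) → Fin M2 → (Fin t → BSig f nb mb) → FSig n m
  encR1 : (t : ℕ) → (Fin t → FSig n m) → BSig f nb mb
  encR2 : (t : ℕ) → (Fin t → FSig n m) → BSig f nb mb
  dec1 : (Fin N → BSig f nb mb) → Fin M1
  dec2 : (Fin N → BSig f nb mb) → Fin M2

variable {n m f nb mb N M1 M2 : ℕ}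

/-- Given a history `h` of source signals `(X_{S1}[·], X_{S2}[·])`, the signal received by
relay 1 at time `s`: `Y_{R1}[s] = S^{q-n} X_{S1}[s] ⊕ S^{q-m} X_{S2}[s]`. -/
def relayRx1 (n m : ℕ) {t : ℕ} (h : Fin t → FSig n m × FSig n m) (s : Fin t) : FSig n m :=
  (shiftMat (max m n) (max m n - n)).mulVec (h s).1 +
  (shiftMat (max m n) (max m n - m)).mulVec (h s).2

/-- `Y_{R2}[s] = S^{q-m} X_{S1}[s] ⊕ S^{q-n} X_{S2}[s]`. -/
def relayRx2 (n m : ℕ) {t : ℕ} (h : Fin t → FSig n m × FSig n m) (s : Fin t) : FSig n m :=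
  (shiftMat (max m n) (max m n - m)).mulVec (h s).1 +
  (shiftMat (max m n) (max m n - n)).mulVec (h s).2

/-- Relay 1 transmitted signal `X_{R1}[s]`, a causal function of `Y_{R1}[1..s-1]`. -/
def relayTx1 (C : Code n m f nb mb N M1 M2) {t : ℕ}
    (h : Fin t → FSig n m × FSig n m) (s : Fin t) : BSig f nb mb :=
  C.encR1 s.val (fun u => relayRx1 n m h ⟨u.val, lt_trans u.isLt s.isLt⟩)

/-- Relay 2 transmitted signal `X_{R2}[s]`, a causal function of `Y_{R2}[1..s-1]`. -/
def relayTx2 (C : Code n m f nb mb N M1 M2) {t : ℕ}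
    (h : Fin t → FSig n m × FSig n m) (s : Fin t) : BSig f nb mb :=
  C.encR2 s.val (fun u => relayRx2 n m h ⟨u.val, lt_trans u.isLt s.isLt⟩)

/-- Source 1 overheard signal `Y_{S1}[s] = S^{q̄-n̄} X_{R1}[s] ⊕ S^{q̄-m̄} X_{R2}[s]`. -/
def srcRx1 (C : Code n m f nb mb N M1 M2) {t : ℕ}
    (h : Fin t → FSig n m × FSig n m) (s : Fin t) : BSig f nb mb :=
  (shiftMat (max mb (max nb f)) (max mb (max nb f) - nb)).mulVec (relayTx1 C h s) +
  (shiftMat (max mb (max nb f)) (max mb (max nb f) - mb)).mulVec (relayTx2 C h s)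

/-- Source 2 overheard signal `Y_{S2}[s] = S^{q̄-n̄} X_{R2}[s] ⊕ S^{q̄-m̄} X_{R1}[s]`. -/
def srcRx2 (C : Code n m f nb mb N M1 M2) {t : ℕ}
    (h : Fin t → FSig n m × FSig n m) (s : Fin t) : BSig f nb mb :=
  (shiftMat (max mb (max nb f)) (max mb (max nb f) - nb)).mulVec (relayTx2 C h s) +
  (shiftMat (max mb (max nb f)) (max mb (max nb f) - mb)).mulVec (relayTx1 C h s)

/-- The history `(X_{S1}[1..t], X_{S2}[1..t])` of source signals determined by the
messages `(w1, w2)`: at each time the sources apply their causal encoders to their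
message and the overheard signals so far. -/
def srcHist (C : Code n m f nb mb N M1 M2) (w1 : Fin M1) (w2 : Fin M2) :
    (t : ℕ) → Fin t → FSig n m × FSig n m
  | 0 => fun i => i.elim0
  | t + 1 =>
    Fin.snoc (srcHist C w1 w2 t)
      (C.encS1 t w1 (srcRx1 C (srcHist C w1 w2 t)),
       C.encS2 t w2 (srcRx2 C (srcHist C w1 w2 t)))

/-- `(X_{S1}[t], X_{S2}[t])`. -/
def srcXat (C : Code n m f nb mb N M1 M2) (w1 : Fin M1) (w2 : Fin M2) (t : ℕ) :
    FSig n m × FSig n m :=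
  srcHist C w1 w2 (t + 1) (Fin.last t)

/-- `Y_{R1}[t]`. -/
def relayRxAt1 (C : Code n m f nb mb N M1 M2) (w1 : Fin M1) (w2 : Fin M2) (t : ℕ) :
    FSig n m :=
  relayRx1 n m (srcHist C w1 w2 (t + 1)) (Fin.last t)

/-- `Y_{R2}[t]`. -/
def relayRxAt2 (C : Code n m f nb mb N M1 M2) (w1 : Fin M1) (w2 : Fin M2) (t : ℕ) :
    FSig n m :=
  relayRx2 n m (srcHist C w1 w2 (t + 1)) (Fin.last t)

/-- `X_{R1}[t]`. -/
def relayTxAt1 (C : Code n m f nb mb N M1 M2) (w1 : Fin M1) (w2 : Fin M2) (t : ℕ) :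
    BSig f nb mb :=
  relayTx1 C (srcHist C w1 w2 (t + 1)) (Fin.last t)

/-- `X_{R2}[t]`. -/
def relayTxAt2 (C : Code n m f nb mb N M1 M2) (w1 : Fin M1) (w2 : Fin M2) (t : ℕ) :
    BSig f nb mb :=
  relayTx2 C (srcHist C w1 w2 (t + 1)) (Fin.last t)

/-- `Y_{D1}[t] = S^{q̄-f} X_{R1}[t]`. -/
def destRx1 (C : Code n m f nb mb N M1 M2) (w1 : Fin M1) (w2 : Fin M2) (t : ℕ) :
    BSig f nb mb :=
  (shiftMat (max mb (max nb f)) (max mb (max nb f) - f)).mulVec (relayTxAt1 C w1 w2 t)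

/-- `Y_{D2}[t] = S^{q̄-f} X_{R2}[t]`. -/
def destRx2 (C : Code n m f nb mb N M1 M2) (w1 : Fin M1) (w2 : Fin M2) (t : ℕ) :
    BSig f nb mb :=
  (shiftMat (max mb (max nb f)) (max mb (max nb f) - f)).mulVec (relayTxAt2 C w1 w2 t)

/-- Probability of decoding error under independent uniform messages: since the channel is
deterministic, this is the fraction of message pairs `(w1, w2)` on which some decoder errs. -/
noncomputable def errProb (C : Code n m f nb mb N M1 M2) : ℝ :=
  ((Finset.univ.filter fun w : Fin M1 × Fin M2 =>
      C.dec1 (fun t => destRx1 C w.1 w.2 t.val) ≠ w.1 ∨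
      C.dec2 (fun t => destRx2 C w.1 w.2 t.val) ≠ w.2).card : ℝ) / ((M1 : ℝ) * (M2 : ℝ))

/-- A nonnegative rate pair `(R1, R2)` is achievable if for every `ε > 0` there is a
blocklength `N ≥ 1` and a code with message sets of sizes `⌈2^(N R1)⌉`, `⌈2^(N R2)⌉`
whose probability of error is at most `ε`. -/
def Achievable (n m f nb mb : ℕ) (R1 R2 : ℝ) : Prop :=
  0 ≤ R1 ∧ 0 ≤ R2 ∧
    ∀ ε : ℝ, 0 < ε →
      ∃ N : ℕ, 0 < N ∧
        ∃ C : Code n m f nb mb N ⌈(2 : ℝ) ^ ((N : ℝ) * R1)⌉₊ ⌈(2 : ℝ) ^ ((N : ℝ) * R2)⌉₊,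
          errProb C ≤ ε

/-- The sum capacity `C_sum = sup { R1 + R2 : (R1, R2) achievable }`. -/
noncomputable def sumCapacity (n m f nb mb : ℕ) : ℝ :=
  sSup {r : ℝ | ∃ R1 R2 : ℝ, Achievable n m f nb mb R1 R2 ∧ r = R1 + R2}

end TwoHopIC

namespace TwoHopIC

/-- The first `N` terms of a random process. -/
def hist {Ω α : Type*} (N : ℕ) (A : ℕ → Ω → α) (ω : Ω) : Fin N → α := fun t => A t ω

lemma hist_eq_iff {Ω α : Type*} {N : ℕ} {A : ℕ → Ω → α} {ω ω' : Ω} :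
    hist N A ω = hist N A ω' ↔ ∀ t < N, A t ω = A t ω' :=
  ⟨fun h t ht => congrFun h ⟨t, ht⟩, fun h => funext fun t => h t t.isLt⟩

section Entropy

variable {Ω : Type*} [Fintype Ω] {α β γ : Type*}

/-- The number of outcomes on which `X` takes the same value as at `ω`. -/
noncomputable def fiberCard (X : Ω → α) (ω : Ω) : ℕ :=
  (Finset.univ.filter fun ω' => X ω' = X ω).card

/-- Shannon entropy (in nats) of `X` when the outcome is uniform on `Ω`. -/
noncomputable def ent (X : Ω → α) : ℝ :=
  (∑ ω, Real.log ((Fintype.card Ω : ℝ) / fiberCard X ω)) / Fintype.card Ω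

lemma fiberCard_pos (X : Ω → α) (ω : Ω) : 0 < fiberCard X ω :=
  Finset.card_pos.2 ⟨ω, by simp⟩

lemma card_pos_of_mem (ω : Ω) : (0 : ℝ) < Fintype.card Ω := by
  exact_mod_cast Fintype.card_pos_iff.2 ⟨ω⟩

lemma ent_mono {X : Ω → α} {Y : Ω → β} (h : ∀ ω ω', Y ω = Y ω' → X ω = X ω') :
    ent X ≤ ent Y := by
  unfold ent
  gcongr with ω _
  · exact div_pos (card_pos_of_mem ω) (by exact_mod_cast fiberCard_pos X ω)
  · exact_mod_cast fiberCard_pos Y ω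
  · exact Finset.card_le_card fun ω' hω' => by
      simp only [Finset.mem_filter, Finset.mem_univ, true_and] at hω' ⊢
      exact h _ _ hω'

/-- Gibbs' inequality: the entropy of `X` given `Y` is at most its cross entropy relative to any
conditional sub-distribution `p`. -/
lemma ent_pair_le_crossEntropy (X : Ω → α) (Y : Ω → β) (p : α → β → ℝ)
    (hpos : ∀ ω, 0 < p (X ω) (Y ω)) (hsum : ∀ (y : β) (s : Finset α), ∑ x ∈ s, p x y ≤ 1) :
    ent (fun ω => (X ω, Y ω)) ≤
      ent Y + (∑ ω, -Real.log (p (X ω) (Y ω))) / Fintype.card Ω := by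
  set XY : Ω → α × β := fun ω => (X ω, Y ω) with hXY
  have hinner : ∀ ω' : Ω, ∑ ω, (if Y ω' = Y ω then p (X ω) (Y ω) / fiberCard XY ω else 0) ≤ 1 := by
    intro ω'
    rw [← Finset.sum_filter]
    set s := Finset.univ.filter fun ω => Y ω' = Y ω with hs
    have hfib : ∀ ω ∈ s, p (X ω) (Y ω) / (fiberCard XY ω : ℝ) =
        p (X ω) (Y ω') / ((s.filter fun a => X a = X ω).card : ℝ) := by
      intro ω hω
      have hY : Y ω' = Y ω := by simpa [hs] using hω
      have : fiberCard XY ω = (s.filter fun a => X a = X ω).card := by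
        unfold fiberCard
        congr 1
        ext a
        simp only [hXY, hs, Finset.mem_filter, Finset.mem_univ, true_and, Prod.mk.injEq, hY]
        tauto
      rw [this, hY]
    rw [Finset.sum_congr rfl hfib,
      Finset.sum_comp (fun x => p x (Y ω') / ((s.filter fun a => X a = x).card : ℝ)) X]
    refine le_trans (le_of_eq (Finset.sum_congr rfl fun x hx => ?_)) (hsum (Y ω') (s.image X))
    have hne : ((s.filter fun a => X a = x).card : ℝ) ≠ 0 := by
      obtain ⟨a, ha, rfl⟩ := Finset.mem_image.1 hx
      exact_mod_cast (Finset.card_pos.2 ⟨a, by simp [ha]⟩).ne'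
    rw [nsmul_eq_mul]
    field_simp
  have htotal : ∑ ω, p (X ω) (Y ω) * fiberCard Y ω / fiberCard XY ω ≤ Fintype.card Ω := by
    have : ∀ ω, p (X ω) (Y ω) * fiberCard Y ω / fiberCard XY ω =
        ∑ ω', (if Y ω' = Y ω then p (X ω) (Y ω) / fiberCard XY ω else 0) := by
      intro ω
      rw [← Finset.sum_filter, Finset.sum_const, nsmul_eq_mul]
      unfold fiberCard
      ring
    rw [Finset.sum_congr rfl fun ω _ => this ω, Finset.sum_comm]
    calc _ ≤ ∑ _ω' : Ω, (1 : ℝ) := Finset.sum_le_sum fun ω' _ => hinner ω'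
      _ = _ := by simp
  unfold ent
  rw [← add_div, ← Finset.sum_add_distrib]
  refine div_le_div_of_nonneg_right ?_ (Nat.cast_nonneg _)
  rw [← sub_nonneg, ← Finset.sum_sub_distrib]
  have hterm : ∀ ω, 1 - p (X ω) (Y ω) * fiberCard Y ω / fiberCard XY ω ≤
      Real.log ((Fintype.card Ω : ℝ) / fiberCard Y ω) + -Real.log (p (X ω) (Y ω)) -
        Real.log ((Fintype.card Ω : ℝ) / fiberCard XY ω) := by
    intro ω
    have h1 : (0 : ℝ) < fiberCard Y ω := by exact_mod_cast fiberCard_pos Y ω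
    have h2 : (0 : ℝ) < fiberCard XY ω := by exact_mod_cast fiberCard_pos XY ω
    have h3 := card_pos_of_mem ω
    have h4 := hpos ω
    have hlog := Real.log_le_sub_one_of_pos
      (show 0 < p (X ω) (Y ω) * fiberCard Y ω / fiberCard XY ω by positivity)
    rw [Real.log_div (by positivity) h2.ne', Real.log_mul h4.ne' h1.ne'] at hlog
    rw [Real.log_div h3.ne' h1.ne', Real.log_div h3.ne' h2.ne']
    linarith
  refine le_trans ?_ (Finset.sum_le_sum fun ω _ => hterm ω)
  rw [Finset.sum_sub_distrib]
  simpa using htotal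

/-- Submodularity of entropy. -/
lemma ent_submodular (X : Ω → α) (Y : Ω → β) (Z : Ω → γ) :
    ent (fun ω => (X ω, Y ω, Z ω)) + ent Z ≤
      ent (fun ω => (X ω, Z ω)) + ent (fun ω => (Y ω, Z ω)) := by
  have h := ent_pair_le_crossEntropy X (fun ω => (Y ω, Z ω))
    (fun x y => ((Finset.univ.filter fun ω => X ω = x ∧ Z ω = y.2).card : ℝ) /
      (Finset.univ.filter fun ω => Z ω = y.2).card)
    (fun ω => div_pos
      (by exact_mod_cast Finset.card_pos.2 ⟨ω, by simp⟩)
      (by exact_mod_cast Finset.card_pos.2 ⟨ω, by simp⟩))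
    (fun y s => by
      rw [← Finset.sum_div]
      refine div_le_one_of_le₀ ?_ (Nat.cast_nonneg _)
      have h := Finset.sum_card_fiberwise_eq_card_filter
        (Finset.univ.filter fun ω => Z ω = y.2) s X
      simp only [Finset.filter_filter] at h
      have h' : ∑ x ∈ s, (Finset.univ.filter fun ω => X ω = x ∧ Z ω = y.2).card ≤
          (Finset.univ.filter fun ω => Z ω = y.2).card := by
        simp only [and_comm (b := Z _ = y.2)]
        rw [h]
        exact Finset.card_le_card fun ω hω => by
          simp only [Finset.mem_filter, Finset.mem_univ, true_and] at hω ⊢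
          exact hω.1
      exact_mod_cast h')
  have hcross : (∑ ω, -Real.log (((Finset.univ.filter fun ω' => X ω' = X ω ∧ Z ω' = Z ω).card : ℝ) /
      (Finset.univ.filter fun ω' => Z ω' = Z ω).card)) / Fintype.card Ω =
      ent (fun ω => (X ω, Z ω)) - ent Z := by
    unfold ent
    rw [← sub_div, ← Finset.sum_sub_distrib]
    congr 1
    refine Finset.sum_congr rfl fun ω _ => ?_
    have h1 : (0 : ℝ) < fiberCard Z ω := by exact_mod_cast fiberCard_pos Z ω
    have h2 : (0 : ℝ) < fiberCard (fun ω => (X ω, Z ω)) ω := by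
      exact_mod_cast fiberCard_pos _ ω
    have h3 := card_pos_of_mem ω
    rw [Real.log_div h3.ne' h1.ne', Real.log_div h3.ne' h2.ne']
    unfold fiberCard at *
    simp only [Prod.mk.injEq] at *
    rw [Real.log_div h2.ne' h1.ne']
    ring
  simp only at h
  rw [hcross] at h
  linarith

/-- Conditioning on more reduces entropy: if `Z` determines `Y`, then
`H(X | Z) ≤ H(X | Y)`. -/
lemma ent_pair_add_le {X : Ω → α} {Y : Ω → β} {Z : Ω → γ}
    (h : ∀ ω ω', Z ω = Z ω' → Y ω = Y ω') :
    ent (fun ω => (X ω, Z ω)) + ent Y ≤ ent (fun ω => (X ω, Y ω)) + ent Z := by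
  have h1 := ent_submodular X Z Y
  have h2 : ent (fun ω => (X ω, Z ω)) ≤ ent (fun ω => (X ω, Z ω, Y ω)) :=
    ent_mono fun ω ω' => by simp; tauto
  have h3 : ent (fun ω => (Z ω, Y ω)) ≤ ent Z :=
    ent_mono fun ω ω' e => by simp [e, h _ _ e]
  linarith

/-- Observing a finitely valued `X` adds at most `log |α|` to the entropy. -/
lemma ent_pair_le_add_log_card [Fintype α] (X : Ω → α) (Y : Ω → β) :
    ent (fun ω => (X ω, Y ω)) ≤ ent Y + Real.log (Fintype.card α) := by
  rcases isEmpty_or_nonempty Ω with hΩ | ⟨⟨ω₀⟩⟩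
  · simp only [ent, Finset.univ_eq_empty, Finset.sum_empty, zero_div, zero_add]
    exact Real.log_natCast_nonneg _
  have hα : (0 : ℝ) < Fintype.card α := by exact_mod_cast Fintype.card_pos_iff.2 ⟨X ω₀⟩
  have hΩ := card_pos_of_mem ω₀
  have h := ent_pair_le_crossEntropy X Y (fun _ _ => (Fintype.card α : ℝ)⁻¹)
    (fun _ => inv_pos.2 hα)
    (fun _ s => by
      rw [Finset.sum_const, nsmul_eq_mul, ← div_eq_mul_inv]
      exact div_le_one_of_le₀ (by exact_mod_cast Finset.card_le_univ s) hα.le)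
  simpa [hΩ.ne'] using h

/-- Fano's inequality, for a decoder `g` erring with probability at most `ε`. -/
lemma ent_fano [Fintype α] (X : Ω → α) (Y : Ω → β) (g : β → α) {ε : ℝ} (hε : 0 < ε) (hε' : ε < 1)
    (herr : ((Finset.univ.filter fun ω => g (Y ω) ≠ X ω).card : ℝ) ≤ ε * Fintype.card Ω) :
    ent (fun ω => (X ω, Y ω)) ≤
      ent Y + (ε * Real.log (Fintype.card α) + Real.negMulLog ε - Real.log (1 - ε)) := by
  have hlog : Real.log (1 - ε) ≤ 0 := Real.log_nonpos (by linarith) (by linarith)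
  have hneg : 0 ≤ Real.negMulLog ε := Real.negMulLog_nonneg hε.le hε'.le
  have hcard0 : 0 ≤ Real.log (Fintype.card α) := Real.log_natCast_nonneg _
  rcases isEmpty_or_nonempty Ω with hΩ | ⟨⟨ω₀⟩⟩
  · simp only [ent, Finset.univ_eq_empty, Finset.sum_empty, zero_div, zero_add]
    have := mul_nonneg hε.le hcard0
    linarith
  have hα : (0 : ℝ) < Fintype.card α := by exact_mod_cast Fintype.card_pos_iff.2 ⟨X ω₀⟩
  have hΩ := card_pos_of_mem ω₀
  have h := ent_pair_le_crossEntropy X Y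
    (fun x y => if g y = x then 1 - ε else ε / Fintype.card α)
    (fun ω => by split_ifs <;> [linarith; positivity])
    (fun y s => by
      have hle : ∀ x ∈ s, (if g y = x then 1 - ε else ε / Fintype.card α) ≤
          (if g y = x then 1 - ε else 0) + ε / Fintype.card α := by
        intro x _
        have : 0 ≤ ε / Fintype.card α := by positivity
        split_ifs <;> linarith
      refine (Finset.sum_le_sum hle).trans ?_
      rw [Finset.sum_add_distrib, Finset.sum_ite_eq, Finset.sum_const, nsmul_eq_mul]
      have h1 : (s.card : ℝ) * (ε / Fintype.card α) ≤ ε := by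
        have : (s.card : ℝ) ≤ Fintype.card α := by exact_mod_cast Finset.card_le_univ s
        calc (s.card : ℝ) * (ε / Fintype.card α) ≤ Fintype.card α * (ε / Fintype.card α) := by
              gcongr
          _ = ε := by field_simp
      split_ifs <;> linarith)
  refine h.trans (add_le_add_right ?_ _)
  rw [div_le_iff₀ hΩ]
  set K := Real.log (Fintype.card α) - Real.log ε with hK
  have hK0 : 0 ≤ K := by
    have := Real.log_nonpos hε.le hε'.le
    linarith
  have hterm : ∀ ω, -Real.log (if g (Y ω) = X ω then 1 - ε else ε / Fintype.card α) ≤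
      -Real.log (1 - ε) + (if g (Y ω) ≠ X ω then K else 0) := by
    intro ω
    by_cases hω : g (Y ω) = X ω
    · simp [hω]
    · simp only [hω, if_false, ne_eq, not_false_eq_true, if_true]
      rw [Real.log_div hε.ne' hα.ne']
      linarith
  refine (Finset.sum_le_sum fun ω _ => hterm ω).trans ?_
  rw [Finset.sum_add_distrib, ← Finset.sum_filter, Finset.sum_const, Finset.sum_const,
    nsmul_eq_mul, nsmul_eq_mul, Finset.card_univ]
  have := mul_le_mul_of_nonneg_right herr hK0
  have hexp : ε * Real.log (Fintype.card α) + Real.negMulLog ε = ε * K := by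
    rw [hK, Real.negMulLog]
    ring
  rw [hexp]
  linarith

/-- If `Y` together with `N` words of `k` bits determines `X`, then `H(X) ≤ H(Y) + N k log 2`. -/
lemma ent_le_add_bits {N k : ℕ} {X : Ω → α} {Y : Ω → β} (B : ℕ → Ω → Fin k → ZMod 2)
    (h : ∀ ω ω', Y ω = Y ω' → (∀ t < N, B t ω = B t ω') → X ω = X ω') :
    ent X ≤ ent Y + N * k * Real.log 2 := by
  have h1 : ent X ≤ ent (fun ω => (hist N B ω, Y ω)) := ent_mono fun ω ω' e => by
    rw [Prod.mk.injEq] at e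
    exact h ω ω' e.2 (hist_eq_iff.1 e.1)
  have h2 := ent_pair_le_add_log_card (hist N B) Y
  have h3 : Real.log (Fintype.card (Fin N → Fin k → ZMod 2)) = N * k * Real.log 2 := by
    simp only [Fintype.card_fun, ZMod.card, Fintype.card_fin]
    push_cast
    rw [← pow_mul, Real.log_pow]
    push_cast
    ring
  linarith

lemma ent_const (c : α) : ent (fun _ : Ω => c) = 0 := by
  unfold ent fiberCard
  rcases isEmpty_or_nonempty Ω with hΩ | ⟨⟨ω₀⟩⟩
  · simp
  · simp [(card_pos_of_mem ω₀).ne']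

end Entropy

section Bits

variable {q : ℕ}

/-- The `k` bits of `x` from position `a` on, positions past the end reading `0`. -/
def window (a k : ℕ) (x : Fin q → ZMod 2) : Fin k → ZMod 2 :=
  fun i => if h : a + i < q then x ⟨a + i, h⟩ else 0

lemma window_eq_iff {a k : ℕ} {x y : Fin q → ZMod 2} :
    window a k x = window a k y ↔ ∀ i : Fin q, a ≤ i → (i : ℕ) < a + k → x i = y i := by
  constructor
  · intro h i hai hik
    have := congrFun h ⟨i - a, by omega⟩
    simpa [window, Nat.add_sub_cancel' hai] using this
  · intro h
    funext i
    unfold window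
    split_ifs with hi
    · exact h ⟨a + i, hi⟩ (by simp) (by simp)
    · rfl

lemma shiftMat_mulVec_apply (k : ℕ) (x : Fin q → ZMod 2) (i : Fin q) :
    (shiftMat q k).mulVec x i = if h : k ≤ i then x ⟨i - k, by omega⟩ else 0 := by
  simp only [Matrix.mulVec, dotProduct, shiftMat, Matrix.of_apply, ite_mul, one_mul, zero_mul]
  split_ifs with h
  · rw [Finset.sum_eq_single ⟨i - k, by omega⟩]
    · simp [Nat.sub_add_cancel h]
    · intro j _ hj
      rw [if_neg]
      intro e
      exact hj (Fin.ext (by simp; omega))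
    · simp
  · refine Finset.sum_eq_zero fun j _ => if_neg (by omega)

/-- For `k ≤ q`, the shift `S^(q-k)` reveals exactly the first `k` bits. -/
lemma shiftMat_mulVec_eq_iff {k : ℕ} (hk : k ≤ q) {x y : Fin q → ZMod 2} :
    (shiftMat q (q - k)).mulVec x = (shiftMat q (q - k)).mulVec y ↔
      window 0 k x = window 0 k y := by
  rw [window_eq_iff]
  constructor
  · intro h i _ hi
    have := congrFun h ⟨i + (q - k), by omega⟩
    simpa [shiftMat_mulVec_apply] using this
  · intro h
    funext i
    rw [shiftMat_mulVec_apply, shiftMat_mulVec_apply]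
    split_ifs with hi
    · exact h _ (by simp) (by simp; omega)
    · rfl

lemma window_mono {k l : ℕ} (hkl : k ≤ l) {x y : Fin q → ZMod 2}
    (h : window 0 l x = window 0 l y) : window 0 k x = window 0 k y := by
  rw [window_eq_iff] at h ⊢
  exact fun i h0 hi => h i h0 (by omega)

end Bits

/-- The random signals of a code: messages `W1`, `W2`, source inputs `X1`, `X2` and relay inputs
`Z1`, `Z2` subject to the causality constraints. -/
structure RandomSignals (Ω : Type*) (n m f nb mb M1 M2 : ℕ) where
  W1 : Ω → Fin M1
  W2 : Ω → Fin M2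
  X1 : ℕ → Ω → FSig n m
  X2 : ℕ → Ω → FSig n m
  Z1 : ℕ → Ω → BSig f nb mb
  Z2 : ℕ → Ω → BSig f nb mb
  relay1_causal : ∀ t ω ω',
    (∀ s < t,
      (shiftMat (max m n) (max m n - n)).mulVec (X1 s ω) +
        (shiftMat (max m n) (max m n - m)).mulVec (X2 s ω) =
      (shiftMat (max m n) (max m n - n)).mulVec (X1 s ω') +
        (shiftMat (max m n) (max m n - m)).mulVec (X2 s ω')) → Z1 t ω = Z1 t ω'
  relay2_causal : ∀ t ω ω',
    (∀ s < t,
      (shiftMat (max m n) (max m n - n)).mulVec (X2 s ω) +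
        (shiftMat (max m n) (max m n - m)).mulVec (X1 s ω) =
      (shiftMat (max m n) (max m n - n)).mulVec (X2 s ω') +
        (shiftMat (max m n) (max m n - m)).mulVec (X1 s ω')) → Z2 t ω = Z2 t ω'
  source1_causal : ∀ t ω ω', W1 ω = W1 ω' →
    (∀ s < t,
      (shiftMat (max mb (max nb f)) (max mb (max nb f) - nb)).mulVec (Z1 s ω) +
        (shiftMat (max mb (max nb f)) (max mb (max nb f) - mb)).mulVec (Z2 s ω) =
      (shiftMat (max mb (max nb f)) (max mb (max nb f) - nb)).mulVec (Z1 s ω') +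
        (shiftMat (max mb (max nb f)) (max mb (max nb f) - mb)).mulVec (Z2 s ω')) →
    X1 t ω = X1 t ω'
  source2_causal : ∀ t ω ω', W2 ω = W2 ω' →
    (∀ s < t,
      (shiftMat (max mb (max nb f)) (max mb (max nb f) - nb)).mulVec (Z2 s ω) +
        (shiftMat (max mb (max nb f)) (max mb (max nb f) - mb)).mulVec (Z1 s ω) =
      (shiftMat (max mb (max nb f)) (max mb (max nb f) - nb)).mulVec (Z2 s ω') +
        (shiftMat (max mb (max nb f)) (max mb (max nb f) - mb)).mulVec (Z1 s ω')) →
    X2 t ω = X2 t ω'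

namespace RandomSignals

variable {Ω : Type*} {n m f nb mb M1 M2 : ℕ}

/-- Exchange the roles of the two users. -/
def swap (P : RandomSignals Ω n m f nb mb M1 M2) : RandomSignals Ω n m f nb mb M2 M1 where
  W1 := P.W2
  W2 := P.W1
  X1 := P.X2
  X2 := P.X1
  Z1 := P.Z2
  Z2 := P.Z1
  relay1_causal := P.relay2_causal
  relay2_causal := P.relay1_causal
  source1_causal := P.source2_causal
  source2_causal := P.source1_causal

variable (P : RandomSignals Ω n m f nb mb M1 M2)

/-- Signal received by relay 1. -/
def Y1 (t : ℕ) (ω : Ω) : FSig n m :=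
  (shiftMat (max m n) (max m n - n)).mulVec (P.X1 t ω) +
    (shiftMat (max m n) (max m n - m)).mulVec (P.X2 t ω)

/-- Signal overheard by source 1. -/
def F1 (t : ℕ) (ω : Ω) : BSig f nb mb :=
  (shiftMat (max mb (max nb f)) (max mb (max nb f) - nb)).mulVec (P.Z1 t ω) +
    (shiftMat (max mb (max nb f)) (max mb (max nb f) - mb)).mulVec (P.Z2 t ω)

/-- Signal received by destination 1. -/
def D1 (t : ℕ) (ω : Ω) : BSig f nb mb :=
  (shiftMat (max mb (max nb f)) (max mb (max nb f) - f)).mulVec (P.Z1 t ω)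

/-- The bits of source 1 visible at relay 2. -/
def V1 (t : ℕ) (ω : Ω) : Fin m → ZMod 2 := window 0 m (P.X1 t ω)

variable {P} {t N : ℕ} {ω ω' : Ω}

lemma Z1_congr (h : ∀ s < t, P.Y1 s ω = P.Y1 s ω') : P.Z1 t ω = P.Z1 t ω' :=
  P.relay1_causal t ω ω' h

lemma X1_congr (hW : P.W1 ω = P.W1 ω') (h : ∀ s < t, P.F1 s ω = P.F1 s ω') :
    P.X1 t ω = P.X1 t ω' :=
  P.source1_causal t ω ω' hW h

lemma Z2_congr (h : ∀ s < t, P.swap.Y1 s ω = P.swap.Y1 s ω') : P.Z2 t ω = P.Z2 t ω' :=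
  Z1_congr (P := P.swap) h

lemma X2_congr (hW : P.W2 ω = P.W2 ω') (h : ∀ s < t, P.swap.F1 s ω = P.swap.F1 s ω') :
    P.X2 t ω = P.X2 t ω' :=
  X1_congr (P := P.swap) hW h

lemma F1_congr (h1 : window 0 nb (P.Z1 t ω) = window 0 nb (P.Z1 t ω'))
    (h2 : window 0 mb (P.Z2 t ω) = window 0 mb (P.Z2 t ω')) : P.F1 t ω = P.F1 t ω' := by
  unfold F1
  rw [(shiftMat_mulVec_eq_iff (by omega)).2 h1, (shiftMat_mulVec_eq_iff (by omega)).2 h2]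

lemma F1_congr_of_Z (h1 : P.Z1 t ω = P.Z1 t ω') (h2 : P.Z2 t ω = P.Z2 t ω') :
    P.F1 t ω = P.F1 t ω' :=
  F1_congr (by rw [h1]) (by rw [h2])

lemma D1_congr (h : window 0 f (P.Z1 t ω) = window 0 f (P.Z1 t ω')) : P.D1 t ω = P.D1 t ω' :=
  (shiftMat_mulVec_eq_iff (by omega)).2 h

lemma Y1_congr (h1 : window 0 n (P.X1 t ω) = window 0 n (P.X1 t ω'))
    (h2 : P.swap.V1 t ω = P.swap.V1 t ω') : P.Y1 t ω = P.Y1 t ω' := by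
  unfold Y1
  rw [(shiftMat_mulVec_eq_iff (by omega)).2 h1]
  exact congrArg _ ((shiftMat_mulVec_eq_iff (by omega)).2 h2)

lemma V1_congr (h : P.X1 t ω = P.X1 t ω') : P.V1 t ω = P.V1 t ω' := by
  unfold V1
  rw [h]

lemma V2_congr (h1 : P.X1 t ω = P.X1 t ω') (h2 : P.Y1 t ω = P.Y1 t ω') :
    P.swap.V1 t ω = P.swap.V1 t ω' := by
  unfold Y1 at h2
  rw [h1] at h2
  exact (shiftMat_mulVec_eq_iff (by omega)).1 (add_left_cancel h2)

lemma D1_congr_of_Y (h : ∀ s < N, P.Y1 s ω = P.Y1 s ω') (ht : t < N) : P.D1 t ω = P.D1 t ω' :=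
  D1_congr (by rw [Z1_congr fun s hs => h s (hs.trans ht)])

/-- Given `W1`, the first relay's signal and the bits of source 2 hidden from it determine the
second relay's signal. -/
lemma Y2_congr_of_W1 (hW : P.W1 ω = P.W1 ω') (hY : ∀ s < N, P.Y1 s ω = P.Y1 s ω')
    (hB : ∀ s < N, window m (n - m) (P.X2 s ω) = window m (n - m) (P.X2 s ω')) :
    ∀ t < N, P.swap.Y1 t ω = P.swap.Y1 t ω' := by
  intro t
  induction t using Nat.strong_induction_on with
  | _ t ih =>
    intro ht
    have hX1 : P.X1 t ω = P.X1 t ω' := X1_congr hW fun s hs =>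
      F1_congr_of_Z (Z1_congr fun r hr => hY r (by omega))
        (Z2_congr fun r hr => ih r (by omega) (by omega))
    have hV2 := V2_congr hX1 (hY t ht)
    refine Y1_congr (P := P.swap) ?_ (V1_congr (P := P) hX1)
    have hb := hB t ht
    unfold V1 at hV2
    rw [window_eq_iff] at hV2 hb ⊢
    intro i _ hi
    by_cases him : (i : ℕ) < m
    · exact hV2 i (by omega) (by omega)
    · exact hb i (by omega) (by omega)

variable [Fintype Ω]

variable (P N) in
/-- The equivocation `H(W1 | D1)` at destination 1. -/
noncomputable def equiv1 : ℝ :=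
  ent (fun ω => (P.W1 ω, hist N P.D1 ω)) - ent (hist N P.D1)

/-- Any observation determining the signal at destination 1 leaves at most the equivocation
there. -/
lemma ent_W1_pair_le {β : Type*} {Y : Ω → β}
    (h : ∀ ω ω', Y ω = Y ω' → ∀ t < N, P.D1 t ω = P.D1 t ω') :
    ent (fun ω => (P.W1 ω, Y ω)) ≤ ent Y + P.equiv1 N := by
  have := ent_pair_add_le (X := P.W1) (Y := hist N P.D1) (Z := Y)
    fun ω ω' e => hist_eq_iff.2 (h ω ω' e)
  unfold equiv1
  linarith

lemma rate1_le_f : ent P.W1 ≤ N * f * Real.log 2 + P.equiv1 N := by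
  have h1 := ent_W1_pair_le (P := P) (N := N) (Y := hist N P.D1)
    fun ω ω' e => hist_eq_iff.1 e
  have h2 : ent P.W1 ≤ ent (fun ω => (P.W1 ω, hist N P.D1 ω)) :=
    ent_mono fun ω ω' e => (Prod.mk.inj e).1
  have h3 : ent (hist N P.D1) ≤ ent (fun _ : Ω => ()) + N * f * Real.log 2 :=
    ent_le_add_bits (fun t ω => window 0 f (P.Z1 t ω)) fun ω ω' _ h =>
      hist_eq_iff.2 fun t ht => D1_congr (h t ht)
  rw [ent_const] at h3
  linarith

/-- The sum-rate bound that survives even full output feedback. -/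
lemma sum_rate_le_max :
    ent (fun ω => (P.W2 ω, P.W1 ω)) ≤
      N * ((max m n : ℕ) + (n - m : ℕ)) * Real.log 2 + P.equiv1 N + P.swap.equiv1 N := by
  have h1 := ent_W1_pair_le (P := P) (N := N) (Y := hist N P.Y1)
    fun ω ω' e t ht => D1_congr_of_Y (hist_eq_iff.1 e) ht
  have h2 : ent (hist N P.Y1) ≤ ent (fun _ : Ω => ()) + N * (max m n : ℕ) * Real.log 2 :=
    ent_le_add_bits P.Y1 fun ω ω' _ h => hist_eq_iff.2 h
  have h3 : ent (fun ω => (hist N P.swap.Y1 ω, P.W1 ω, hist N P.Y1 ω)) ≤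
      ent (fun ω => (P.W1 ω, hist N P.Y1 ω)) + N * (n - m : ℕ) * Real.log 2 :=
    ent_le_add_bits (fun t ω => window m (n - m) (P.X2 t ω)) fun ω ω' e h => by
      simp only [Prod.mk.injEq] at e ⊢
      exact ⟨hist_eq_iff.2 (Y2_congr_of_W1 e.1 (hist_eq_iff.1 e.2) h), e⟩
  have h4 := ent_W1_pair_le (P := P.swap) (N := N)
    (Y := fun ω => (hist N P.swap.Y1 ω, P.W1 ω, hist N P.Y1 ω))
    fun ω ω' e t ht => D1_congr_of_Y (hist_eq_iff.1 (Prod.mk.inj e).1) ht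
  have h5 : ent (fun ω => (P.W2 ω, P.W1 ω)) ≤
      ent (fun ω => (P.swap.W1 ω, hist N P.swap.Y1 ω, P.W1 ω, hist N P.Y1 ω)) :=
    ent_mono fun ω ω' e => by
      simp only [Prod.mk.injEq] at e ⊢
      exact ⟨e.1, e.2.2.1⟩
  rw [ent_const] at h2
  linarith

/-- Cut-set bound separating source 1 and relay 2 from the other nodes. -/
lemma rate1_le_cutset :
    ent (fun ω => (P.W1 ω, P.W2 ω)) ≤
      ent P.W2 + N * (n + nb) * Real.log 2 + P.equiv1 N := by
  have h1 : ent (fun ω => (hist N P.Y1 ω, P.W2 ω)) ≤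
      ent (fun ω => (hist N (fun t ω => window 0 nb (P.Z2 t ω)) ω, P.W2 ω)) +
        N * n * Real.log 2 := by
    refine ent_le_add_bits (fun t ω => window 0 n (P.X1 t ω)) fun ω ω' e h => ?_
    simp only [Prod.mk.injEq] at e ⊢
    refine ⟨hist_eq_iff.2 fun t => ?_, e.2⟩
    induction t using Nat.strong_induction_on with
    | _ t ih =>
      intro ht
      refine Y1_congr (h t ht) (V1_congr (P := P.swap) (X2_congr e.2 fun s hs => ?_))
      refine F1_congr (P := P.swap) (hist_eq_iff.1 e.1 s (by omega)) ?_
      exact congrArg _ (Z1_congr fun r hr => ih r (by omega) (by omega))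
  have h2 : ent (fun ω => (hist N (fun t ω => window 0 nb (P.Z2 t ω)) ω, P.W2 ω)) ≤
      ent P.W2 + N * nb * Real.log 2 :=
    ent_le_add_bits (fun t ω => window 0 nb (P.Z2 t ω)) fun ω ω' e h => by
      simp only [Prod.mk.injEq]
      exact ⟨hist_eq_iff.2 h, e⟩
  have h3 := ent_W1_pair_le (P := P) (N := N) (Y := fun ω => (hist N P.Y1 ω, P.W2 ω))
    fun ω ω' e t ht => D1_congr_of_Y (hist_eq_iff.1 (Prod.mk.inj e).1) ht
  have h4 : ent (fun ω => (P.W1 ω, P.W2 ω)) ≤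
      ent (fun ω => (P.W1 ω, hist N P.Y1 ω, P.W2 ω)) := ent_mono fun ω ω' e => by
    simp only [Prod.mk.injEq] at e ⊢
    exact ⟨e.1, e.2.2⟩
  linarith

/-- Sum-rate bound obtained by revealing the visible output of relay 2 and then `W2`. -/
lemma sum_rate_le_relay_output :
    ent (fun ω => (P.W1 ω, P.W2 ω)) ≤
      N * (n + (max nb f : ℕ)) * Real.log 2 + P.equiv1 N + P.swap.equiv1 N := by
  set U : ℕ → Ω → Fin (max nb f) → ZMod 2 := fun t ω => window 0 (max nb f) (P.Z2 t ω) with hU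
  have h1 : ent (hist N U) ≤ ent (fun _ : Ω => ()) + N * (max nb f : ℕ) * Real.log 2 :=
    ent_le_add_bits U fun ω ω' _ h => hist_eq_iff.2 h
  have h2 := ent_W1_pair_le (P := P.swap) (N := N) (Y := hist N U)
    fun ω ω' e t ht => D1_congr (P := P.swap)
      (window_mono (le_max_right nb f) (hist_eq_iff.1 e t ht))
  have h3 : ent (fun ω => (hist N P.Y1 ω, P.W2 ω, hist N U ω)) ≤
      ent (fun ω => (P.swap.W1 ω, hist N U ω)) + N * n * Real.log 2 := by
    refine ent_le_add_bits (fun t ω => window 0 n (P.X1 t ω)) fun ω ω' e h => ?_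
    simp only [Prod.mk.injEq] at e ⊢
    refine ⟨hist_eq_iff.2 fun t => ?_, e⟩
    induction t using Nat.strong_induction_on with
    | _ t ih =>
      intro ht
      refine Y1_congr (h t ht) (V1_congr (P := P.swap) (X2_congr e.1 fun s hs => ?_))
      refine F1_congr (P := P.swap)
        (window_mono (le_max_left nb f) (hist_eq_iff.1 e.2 s (by omega))) ?_
      exact congrArg _ (Z1_congr fun r hr => ih r (by omega) (by omega))
  have h4 := ent_W1_pair_le (P := P) (N := N)
    (Y := fun ω => (hist N P.Y1 ω, P.W2 ω, hist N U ω))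
    fun ω ω' e t ht => D1_congr_of_Y (hist_eq_iff.1 (Prod.mk.inj e).1) ht
  have h5 : ent (fun ω => (P.W1 ω, P.W2 ω)) ≤
      ent (fun ω => (P.W1 ω, hist N P.Y1 ω, P.W2 ω, hist N U ω)) := ent_mono fun ω ω' e => by
    simp only [Prod.mk.injEq] at e ⊢
    exact ⟨e.1, e.2.2.1⟩
  rw [ent_const] at h1
  linarith

/-- For `m ≤ n`, the bits of source 1 visible at relay 2 leave at most `max (n - m) m` bits of the
first relay's signal unknown per time slot. -/
lemma ent_Y1_V1_le (hmn : m ≤ n) :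
    ent (fun ω => (hist N P.Y1 ω, hist N P.V1 ω)) ≤
      ent (hist N P.V1) + N * (max (n - m) m : ℕ) * Real.log 2 := by
  refine ent_le_add_bits (fun t ω => window (min m (n - m)) (max (n - m) m) (P.Y1 t ω))
    fun ω ω' e h => ?_
  simp only [Prod.mk.injEq]
  refine ⟨hist_eq_iff.2 fun t ht => ?_, e⟩
  funext i
  have hq : max m n = n := max_eq_right hmn
  by_cases hi : (i : ℕ) < min m (n - m)
  · have hV := hist_eq_iff.1 e t ht
    unfold V1 at hV
    rw [window_eq_iff] at hV
    have hX := hV i (by omega) (by omega)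
    unfold Y1
    simp only [Pi.add_apply, shiftMat_mulVec_apply]
    rw [dif_neg (show ¬ max m n - m ≤ (i : ℕ) by omega),
      dif_neg (show ¬ max m n - m ≤ (i : ℕ) by omega),
      dif_pos (show max m n - n ≤ (i : ℕ) by omega),
      dif_pos (show max m n - n ≤ (i : ℕ) by omega)]
    simpa [hq] using hX
  · exact window_eq_iff.1 (h t ht) i (by omega) (by omega)

/-- Equivocation bound for the pair observed by relay 1 aided by its user's visible bits. -/
lemma ent_Y1_V1_W1_le (hmn : m ≤ n) :
    ent (fun ω => (P.W1 ω, hist N P.Y1 ω, hist N P.V1 ω)) ≤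
      ent (hist N P.V1) + N * (max (n - m) m : ℕ) * Real.log 2 + P.equiv1 N := by
  have h1 := ent_W1_pair_le (P := P) (N := N) (Y := fun ω => (hist N P.Y1 ω, hist N P.V1 ω))
    fun ω ω' e t ht => D1_congr_of_Y (hist_eq_iff.1 (Prod.mk.inj e).1) ht
  have h2 := ent_Y1_V1_le (P := P) (N := N) hmn
  linarith

/-- The overheard signal carries at most `max nb mb` bits per time slot. -/
lemma ent_F1_W1_le :
    ent (fun ω => (hist N P.F1 ω, P.W1 ω)) ≤
      ent P.W1 + N * (max nb mb : ℕ) * Real.log 2 := by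
  refine ent_le_add_bits
    (fun t ω => window (max mb (max nb f) - max nb mb) (max nb mb) (P.F1 t ω)) fun ω ω' e h => ?_
  simp only [Prod.mk.injEq]
  refine ⟨hist_eq_iff.2 fun t ht => ?_, e⟩
  funext i
  by_cases hi : (i : ℕ) < max mb (max nb f) - max nb mb
  · unfold F1
    simp only [Pi.add_apply, shiftMat_mulVec_apply]
    rw [dif_neg (by omega), dif_neg (by omega), dif_neg (by omega), dif_neg (by omega)]
  · exact window_eq_iff.1 (h t ht) i (by omega) (by omega)

/-- What user 2 can learn about the bits of source 1 through the first hop. -/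
lemma ent_V1_add_le (hind : ent (fun ω => (P.W2 ω, P.W1 ω)) = ent P.W1 + ent P.W2) :
    ent (hist N P.V1) + ent (fun ω => (hist N P.swap.V1 ω, P.W2 ω)) + ent P.W1 ≤
      ent (fun ω => (hist N P.V1 ω, P.W1 ω)) +
        ent (fun ω => (P.W2 ω, hist N P.swap.Y1 ω, hist N P.swap.V1 ω)) +
        N * (max nb mb : ℕ) * Real.log 2 := by
  have h1 := ent_submodular P.W2 P.W1 (hist N P.V1)
  have h2 : ent (fun ω => (P.W2 ω, P.W1 ω)) ≤ ent (fun ω => (P.W2 ω, P.W1 ω, hist N P.V1 ω)) :=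
    ent_mono fun ω ω' e => by
      simp only [Prod.mk.injEq] at e ⊢
      exact ⟨e.1, e.2.1⟩
  have h3 : ent (fun ω => (P.W1 ω, hist N P.V1 ω)) ≤ ent (fun ω => (hist N P.V1 ω, P.W1 ω)) :=
    ent_mono fun ω ω' e => by
      simp only [Prod.mk.injEq] at e ⊢
      exact e.symm
  have h4 := ent_submodular (hist N P.swap.F1) (hist N P.swap.Y1)
    (fun ω => (hist N P.swap.V1 ω, P.W2 ω))
  have h5 : ent (fun ω => (P.W2 ω, hist N P.V1 ω)) ≤
      ent (fun ω => (hist N P.swap.F1 ω, hist N P.swap.Y1 ω, hist N P.swap.V1 ω, P.W2 ω)) :=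
    ent_mono fun ω ω' e => by
      simp only [Prod.mk.injEq] at e ⊢
      refine ⟨e.2.2.2, hist_eq_iff.2 fun t ht => ?_⟩
      refine V2_congr (P := P.swap) (X2_congr e.2.2.2 fun s hs => ?_)
        (hist_eq_iff.1 e.2.1 t ht)
      exact hist_eq_iff.1 e.1 s (by omega)
  have h6 : ent (fun ω => (hist N P.swap.F1 ω, hist N P.swap.V1 ω, P.W2 ω)) ≤
      ent (fun ω => (hist N P.swap.F1 ω, P.swap.W1 ω)) :=
    ent_mono fun ω ω' e => by
      simp only [Prod.mk.injEq] at e ⊢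
      refine ⟨e.1, hist_eq_iff.2 fun t ht => ?_, e.2⟩
      exact V1_congr (P := P.swap) (X2_congr e.2 fun s hs => hist_eq_iff.1 e.1 s (by omega))
  have h7 : ent (fun ω => (hist N P.swap.Y1 ω, hist N P.swap.V1 ω, P.W2 ω)) ≤
      ent (fun ω => (P.W2 ω, hist N P.swap.Y1 ω, hist N P.swap.V1 ω)) :=
    ent_mono fun ω ω' e => by
      simp only [Prod.mk.injEq] at e ⊢
      exact ⟨e.2.1, e.2.2, e.1⟩
  have h8 := ent_F1_W1_le (P := P.swap) (N := N)
  have h9 : ent P.swap.W1 = ent P.W2 := rfl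
  linarith

/-- Sum-rate bound for weak interference with rate-limited feedback. -/
lemma sum_rate_le_feedback (hmn : m ≤ n)
    (hind : ent (fun ω => (P.W2 ω, P.W1 ω)) = ent P.W1 + ent P.W2) :
    ent P.W1 + ent P.W2 ≤
      N * (2 * (max (n - m) m : ℕ) + 2 * (max nb mb : ℕ)) * Real.log 2 +
        P.equiv1 N + P.swap.equiv1 N := by
  have hind' : ent (fun ω => (P.swap.W2 ω, P.swap.W1 ω)) = ent P.swap.W1 + ent P.swap.W2 := by
    have h1 : ent (fun ω => (P.W1 ω, P.W2 ω)) = ent (fun ω => (P.W2 ω, P.W1 ω)) :=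
      le_antisymm (ent_mono fun ω ω' e => by simp only [Prod.mk.injEq] at e ⊢; exact e.symm)
        (ent_mono fun ω ω' e => by simp only [Prod.mk.injEq] at e ⊢; exact e.symm)
    change ent (fun ω => (P.W1 ω, P.W2 ω)) = ent P.W2 + ent P.W1
    rw [h1, hind, add_comm]
  have h1 := ent_V1_add_le (N := N) hind
  have h2 : ent (hist N P.swap.V1) + ent (fun ω => (hist N P.V1 ω, P.W1 ω)) + ent P.W2 ≤
      ent (fun ω => (hist N P.swap.V1 ω, P.W2 ω)) +
        ent (fun ω => (P.W1 ω, hist N P.Y1 ω, hist N P.V1 ω)) +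
        N * (max nb mb : ℕ) * Real.log 2 := ent_V1_add_le (P := P.swap) (N := N) hind'
  have h3 := ent_Y1_V1_W1_le (P := P) (N := N) hmn
  have h4 : ent (fun ω => (P.W2 ω, hist N P.swap.Y1 ω, hist N P.swap.V1 ω)) ≤
      ent (hist N P.swap.V1) + N * (max (n - m) m : ℕ) * Real.log 2 + P.swap.equiv1 N :=
    ent_Y1_V1_W1_le (P := P.swap) (N := N) hmn
  linarith

end RandomSignals

variable {n m f nb mb N M1 M2 : ℕ}

lemma srcHist_apply (C : Code n m f nb mb N M1 M2) (w1 : Fin M1) (w2 : Fin M2) (t : ℕ)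
    (s : Fin t) : srcHist C w1 w2 t s = srcXat C w1 w2 s := by
  induction t with
  | zero => exact s.elim0
  | succ t ih =>
    refine Fin.lastCases ?_ (fun s => ?_) s
    · rfl
    · rw [show srcHist C w1 w2 (t + 1) s.castSucc = srcHist C w1 w2 t s by
        simp [srcHist, Fin.snoc_castSucc], ih]
      rfl

lemma relayRx1_srcHist (C : Code n m f nb mb N M1 M2) (w1 : Fin M1) (w2 : Fin M2) (t : ℕ)
    (s : Fin t) : relayRx1 n m (srcHist C w1 w2 t) s = relayRxAt1 C w1 w2 s := by
  simp [relayRx1, relayRxAt1, srcHist_apply]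

lemma relayRx2_srcHist (C : Code n m f nb mb N M1 M2) (w1 : Fin M1) (w2 : Fin M2) (t : ℕ)
    (s : Fin t) : relayRx2 n m (srcHist C w1 w2 t) s = relayRxAt2 C w1 w2 s := by
  simp [relayRx2, relayRxAt2, srcHist_apply]

lemma relayTx1_srcHist (C : Code n m f nb mb N M1 M2) (w1 : Fin M1) (w2 : Fin M2) (t : ℕ)
    (s : Fin t) : relayTx1 C (srcHist C w1 w2 t) s = relayTxAt1 C w1 w2 s := by
  simp [relayTx1, relayTxAt1, relayRx1_srcHist]

lemma relayTx2_srcHist (C : Code n m f nb mb N M1 M2) (w1 : Fin M1) (w2 : Fin M2) (t : ℕ)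
    (s : Fin t) : relayTx2 C (srcHist C w1 w2 t) s = relayTxAt2 C w1 w2 s := by
  simp [relayTx2, relayTxAt2, relayRx2_srcHist]

lemma relayTxAt1_eq (C : Code n m f nb mb N M1 M2) (w1 : Fin M1) (w2 : Fin M2) (t : ℕ) :
    relayTxAt1 C w1 w2 t = C.encR1 t fun u => relayRxAt1 C w1 w2 u := by
  simp [relayTxAt1, relayTx1, relayRx1_srcHist]

lemma relayTxAt2_eq (C : Code n m f nb mb N M1 M2) (w1 : Fin M1) (w2 : Fin M2) (t : ℕ) :
    relayTxAt2 C w1 w2 t = C.encR2 t fun u => relayRxAt2 C w1 w2 u := by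
  simp [relayTxAt2, relayTx2, relayRx2_srcHist]

lemma srcXat_eq (C : Code n m f nb mb N M1 M2) (w1 : Fin M1) (w2 : Fin M2) (t : ℕ) :
    srcXat C w1 w2 t =
      (C.encS1 t w1 (srcRx1 C (srcHist C w1 w2 t)),
        C.encS2 t w2 (srcRx2 C (srcHist C w1 w2 t))) := by
  simp [srcXat, srcHist, Fin.snoc_last]

/-- The process generated by a code under uniform messages. -/
def Code.signals (C : Code n m f nb mb N M1 M2) :
    RandomSignals (Fin M1 × Fin M2) n m f nb mb M1 M2 where
  W1 := Prod.fst
  W2 := Prod.snd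
  X1 t ω := (srcXat C ω.1 ω.2 t).1
  X2 t ω := (srcXat C ω.1 ω.2 t).2
  Z1 t ω := relayTxAt1 C ω.1 ω.2 t
  Z2 t ω := relayTxAt2 C ω.1 ω.2 t
  relay1_causal t ω ω' h := by
    rw [relayTxAt1_eq, relayTxAt1_eq]
    exact congrArg _ (funext fun u => h u u.isLt)
  relay2_causal t ω ω' h := by
    rw [relayTxAt2_eq, relayTxAt2_eq]
    refine congrArg _ (funext fun u => ?_)
    have := h u u.isLt
    rwa [add_comm, add_comm (Matrix.mulVec _ (srcXat C ω'.1 ω'.2 u).2)] at this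
  source1_causal t ω ω' hW h := by
    rw [srcXat_eq, srcXat_eq]
    refine congrArg₂ (C.encS1 t) hW (funext fun u => ?_)
    simp only [srcRx1, relayTx1_srcHist, relayTx2_srcHist]
    exact h u u.isLt
  source2_causal t ω ω' hW h := by
    rw [srcXat_eq, srcXat_eq]
    refine congrArg₂ (C.encS2 t) hW (funext fun u => ?_)
    simp only [srcRx2, relayTx1_srcHist, relayTx2_srcHist]
    exact h u u.isLt

lemma ent_fst : ent (Prod.fst : Fin M1 × Fin M2 → Fin M1) ≤ Real.log M1 := by
  have h := ent_pair_le_add_log_card (Prod.fst : Fin M1 × Fin M2 → Fin M1) fun _ => ()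
  rw [ent_const, zero_add, Fintype.card_fin] at h
  exact (ent_mono fun ω ω' e => (Prod.mk.inj e).1).trans h

lemma ent_snd : ent (Prod.snd : Fin M1 × Fin M2 → Fin M2) ≤ Real.log M2 := by
  have h := ent_pair_le_add_log_card (Prod.snd : Fin M1 × Fin M2 → Fin M2) fun _ => ()
  rw [ent_const, zero_add, Fintype.card_fin] at h
  exact (ent_mono fun ω ω' e => (Prod.mk.inj e).1).trans h

lemma ent_of_injective {Ω α : Type*} [Fintype Ω] {X : Ω → α} (hX : Function.Injective X) :
    ent X = Real.log (Fintype.card Ω) := by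
  have : ∀ ω, fiberCard X ω = 1 := fun ω => by
    refine Finset.card_eq_one.2 ⟨ω, ?_⟩
    ext ω'
    simp [hX.eq_iff]
  unfold ent
  rcases isEmpty_or_nonempty Ω with hΩ | ⟨⟨ω₀⟩⟩
  · simp
  · simp [this, (card_pos_of_mem ω₀).ne']

/-- The two messages are independent and uniform. -/
lemma ent_messages (h1 : 0 < M1) (h2 : 0 < M2) :
    ent (Prod.fst : Fin M1 × Fin M2 → Fin M1) = Real.log M1 ∧
      ent (Prod.snd : Fin M1 × Fin M2 → Fin M2) = Real.log M2 ∧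
      ent (fun ω : Fin M1 × Fin M2 => (ω.1, ω.2)) = Real.log M1 + Real.log M2 ∧
      ent (fun ω : Fin M1 × Fin M2 => (ω.2, ω.1)) = Real.log M1 + Real.log M2 := by
  have hcard : Real.log (Fintype.card (Fin M1 × Fin M2)) = Real.log M1 + Real.log M2 := by
    rw [Fintype.card_prod, Fintype.card_fin, Fintype.card_fin, Nat.cast_mul,
      Real.log_mul (by positivity) (by positivity)]
  have hpair : ent (fun ω : Fin M1 × Fin M2 => (ω.1, ω.2)) = Real.log M1 + Real.log M2 := by
    rw [ent_of_injective (fun a b h => h), hcard]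
  have hswap : ent (fun ω : Fin M1 × Fin M2 => (ω.2, ω.1)) = Real.log M1 + Real.log M2 := by
    exact (ent_of_injective Prod.swap_injective).trans hcard
  have hfst := ent_pair_le_add_log_card (Prod.fst : Fin M1 × Fin M2 → Fin M1) Prod.snd
  have hsnd := ent_pair_le_add_log_card (Prod.snd : Fin M1 × Fin M2 → Fin M2) Prod.fst
  rw [Fintype.card_fin] at hfst hsnd
  have h3 := ent_fst (M1 := M1) (M2 := M2)
  have h4 := ent_snd (M1 := M1) (M2 := M2)
  exact ⟨by linarith, by linarith, hpair, hswap⟩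

/-- Fano's inequality for both users of a code. -/
lemma Code.equiv_le (C : Code n m f nb mb N M1 M2) (h1 : 0 < M1) (h2 : 0 < M2) {ε : ℝ}
    (hε : 0 < ε) (hε' : ε < 1) (herr : errProb C ≤ ε) :
    C.signals.equiv1 N ≤ ε * Real.log M1 + Real.negMulLog ε - Real.log (1 - ε) ∧
      C.signals.swap.equiv1 N ≤ ε * Real.log M2 + Real.negMulLog ε - Real.log (1 - ε) := by
  have hM : (0 : ℝ) < (M1 : ℝ) * M2 := by positivity
  have hcard : (Fintype.card (Fin M1 × Fin M2) : ℝ) = (M1 : ℝ) * M2 := by simp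
  unfold errProb at herr
  rw [div_le_iff₀ hM] at herr
  have hf1 := ent_fano C.signals.W1 (hist N C.signals.D1) C.dec1 hε hε' (by
    rw [hcard]
    refine le_trans ?_ herr
    exact_mod_cast Finset.card_le_card fun ω hω => by
      simp only [Finset.mem_filter, Finset.mem_univ, true_and] at hω ⊢
      exact Or.inl hω)
  have hf2 := ent_fano C.signals.swap.W1 (hist N C.signals.swap.D1) C.dec2 hε hε' (by
    rw [hcard]
    refine le_trans ?_ herr
    exact_mod_cast Finset.card_le_card fun ω hω => by
      simp only [Finset.mem_filter, Finset.mem_univ, true_and] at hω ⊢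
      exact Or.inr hω)
  rw [Fintype.card_fin] at hf1 hf2
  unfold RandomSignals.equiv1
  constructor <;> linarith

/-- A bound on `log M1 + log M2` up to equivocations, valid for all codes, bounds the sum
capacity. -/
lemma sumCapacity_le_of_code_bound {B : ℝ} (hB : 0 ≤ B)
    (h : ∀ (N M1 M2 : ℕ), 0 < M1 → 0 < M2 → ∀ C : Code n m f nb mb N M1 M2,
      Real.log M1 + Real.log M2 ≤
        N * B * Real.log 2 + C.signals.equiv1 N + C.signals.swap.equiv1 N) :
    sumCapacity n m f nb mb ≤ B := by
  refine Real.sSup_le ?_ hB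
  rintro r ⟨R1, R2, ⟨hR1, hR2, hach⟩, rfl⟩
  have hl2 : 0 < Real.log 2 := Real.log_pos (by norm_num)
  have key : ∀ ε : ℝ, 0 < ε → ε < 1 → (1 - ε) * ((R1 + R2) * Real.log 2) ≤
      B * Real.log 2 + 2 * (Real.negMulLog ε - Real.log (1 - ε)) := by
    intro ε hε hε'
    obtain ⟨N, hN, C, herr⟩ := hach ε hε
    have hpos : ∀ R : ℝ, 0 < ⌈(2 : ℝ) ^ ((N : ℝ) * R)⌉₊ := fun R =>
      Nat.ceil_pos.2 (Real.rpow_pos_of_pos (by norm_num) _)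
    have hlog : ∀ R : ℝ, N * R * Real.log 2 ≤ Real.log (⌈(2 : ℝ) ^ ((N : ℝ) * R)⌉₊ : ℝ) := by
      intro R
      rw [← Real.log_rpow (by norm_num)]
      exact Real.log_le_log (Real.rpow_pos_of_pos (by norm_num) _) (Nat.le_ceil _)
    have hC := h _ _ _ (hpos R1) (hpos R2) C
    obtain ⟨he1, he2⟩ := C.equiv_le (hpos R1) (hpos R2) hε hε' herr
    have hN1 : (1 : ℝ) ≤ N := by exact_mod_cast hN
    have hδ : 0 ≤ Real.negMulLog ε - Real.log (1 - ε) := by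
      have h1 := Real.negMulLog_nonneg hε.le hε'.le
      have h2 : Real.log (1 - ε) ≤ 0 := Real.log_nonpos (by linarith) (by linarith)
      linarith
    have h1 := mul_le_mul_of_nonneg_left (hlog R1) (by linarith : 0 ≤ 1 - ε)
    have h2 := mul_le_mul_of_nonneg_left (hlog R2) (by linarith : 0 ≤ 1 - ε)
    have h3 := mul_le_mul_of_nonneg_right hN1 hδ
    refine le_of_mul_le_mul_left ?_ (by linarith : (0 : ℝ) < N)
    nlinarith
  have hcont : Filter.Tendsto (fun ε : ℝ => B * Real.log 2 +
      2 * (Real.negMulLog ε - Real.log (1 - ε)) - (1 - ε) * ((R1 + R2) * Real.log 2))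
      (nhdsWithin 0 (Set.Ioi 0))
      (nhds (B * Real.log 2 + 2 * (Real.negMulLog 0 - Real.log (1 - 0)) -
        (1 - 0) * ((R1 + R2) * Real.log 2))) := by
    refine Filter.Tendsto.mono_left (ContinuousAt.tendsto ?_) nhdsWithin_le_nhds
    have hlogc : ContinuousAt (fun ε : ℝ => Real.log (1 - ε)) 0 :=
      ContinuousAt.log (by fun_prop) (by norm_num)
    have hneg : ContinuousAt Real.negMulLog 0 := Real.continuous_negMulLog.continuousAt
    fun_prop
  have hlim := ge_of_tendsto hcont (b := 0) (by
    filter_upwards [Ioo_mem_nhdsGT (show (0 : ℝ) < 1 by norm_num)] with ε hε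
    linarith [key ε hε.1 hε.2])
  simp only [Real.negMulLog_zero, sub_zero, Real.log_one, mul_zero, add_zero, one_mul] at hlim
  exact le_of_mul_le_mul_right (by linarith) hl2

lemma sumCapacity_le_two_mul_f : sumCapacity n m f nb mb ≤ 2 * (f : ℝ) := by
  refine sumCapacity_le_of_code_bound (by positivity) fun N M1 M2 h1 h2 C => ?_
  obtain ⟨e1, e2, -, -⟩ := ent_messages h1 h2
  have b1 := C.signals.rate1_le_f (N := N)
  have b2 := C.signals.swap.rate1_le_f (N := N)
  have e1' : ent C.signals.W1 = Real.log M1 := e1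
  have e2' : ent C.signals.swap.W1 = Real.log M2 := e2
  linarith

lemma sumCapacity_le_max :
    sumCapacity n m f nb mb ≤ ((max m n : ℕ) : ℝ) + ((n - m : ℕ) : ℝ) := by
  refine sumCapacity_le_of_code_bound (by positivity) fun N M1 M2 h1 h2 C => ?_
  rw [← (ent_messages h1 h2).2.2.2]
  exact C.signals.sum_rate_le_max

lemma sumCapacity_le_cutset : sumCapacity n m f nb mb ≤ 2 * (n : ℝ) + 2 * nb := by
  refine sumCapacity_le_of_code_bound (by positivity) fun N M1 M2 h1 h2 C => ?_
  obtain ⟨e1, e2, e3, e4⟩ := ent_messages h1 h2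
  have b1 : ent (fun ω : Fin M1 × Fin M2 => (ω.1, ω.2)) ≤ ent (Prod.snd : Fin M1 × Fin M2 → _) +
      N * (n + nb) * Real.log 2 + C.signals.equiv1 N := C.signals.rate1_le_cutset
  have b2 : ent (fun ω : Fin M1 × Fin M2 => (ω.2, ω.1)) ≤ ent (Prod.fst : Fin M1 × Fin M2 → _) +
      N * (n + nb) * Real.log 2 + C.signals.swap.equiv1 N := C.signals.swap.rate1_le_cutset
  linarith

lemma sumCapacity_le_relay_output :
    sumCapacity n m f nb mb ≤ (n : ℝ) + ((max nb f : ℕ) : ℝ) := by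
  refine sumCapacity_le_of_code_bound (by positivity) fun N M1 M2 h1 h2 C => ?_
  rw [← (ent_messages h1 h2).2.2.1]
  exact C.signals.sum_rate_le_relay_output

lemma sumCapacity_le_feedback (hmn : m ≤ n) : sumCapacity n m f nb mb ≤
    2 * ((max (n - m) m : ℕ) : ℝ) + 2 * ((max nb mb : ℕ) : ℝ) := by
  refine sumCapacity_le_of_code_bound (by positivity) fun N M1 M2 h1 h2 C => ?_
  obtain ⟨e1, e2, e3, e4⟩ := ent_messages h1 h2
  rw [← e1, ← e2]
  exact C.signals.sum_rate_le_feedback hmn (e4.trans (by rw [← e1, ← e2]; rfl))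

end TwoHopIC

open TwoHopIC in
/-- Outer bound (Theorem 1). -/
theorem outer_bound (n m f nb mb : ℕ) :
    (3 * m ≤ 2 * n →
      sumCapacity n m f nb mb ≤
        min (2 * max ((n : ℝ) - m) m + 2 * max (nb : ℝ) (mb : ℝ))
          (min (2 * (n : ℝ) - m) (2 * f))) ∧
    (2 * n ≤ 3 * m → m ≤ 2 * n →
      sumCapacity n m f nb mb ≤ min (max (2 * (n : ℝ) - m) (m : ℝ)) (2 * f)) ∧
    (2 * n ≤ m →
      sumCapacity n m f nb mb ≤
        min ((n : ℝ) + f + max ((nb : ℝ) - f) 0)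
          (min (2 * (n : ℝ) + 2 * nb) (min (m : ℝ) (2 * f)))) := by
  have hf := sumCapacity_le_two_mul_f (n := n) (m := m) (f := f) (nb := nb) (mb := mb)
  have hmax := sumCapacity_le_max (n := n) (m := m) (f := f) (nb := nb) (mb := mb)
  refine ⟨fun h => le_min ?_ (le_min ?_ hf), fun h h' => le_min ?_ hf,
    fun h => le_min ?_ (le_min sumCapacity_le_cutset (le_min ?_ hf))⟩
  · have hmn : m ≤ n := by omega
    have := sumCapacity_le_feedback (f := f) (nb := nb) (mb := mb) hmn
    rwa [Nat.cast_max, Nat.cast_max, Nat.cast_sub hmn] at this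
  · have hmn : m ≤ n := by omega
    rw [max_eq_right hmn, Nat.cast_sub hmn] at hmax
    linarith
  · rcases le_total m n with hmn | hmn
    · rw [max_eq_right hmn, Nat.cast_sub hmn] at hmax
      exact le_max_of_le_left (by linarith)
    · rw [max_eq_left hmn, Nat.sub_eq_zero_of_le hmn] at hmax
      exact le_max_of_le_right (by simpa using hmax)
  · have := sumCapacity_le_relay_output (n := n) (m := m) (f := f) (nb := nb) (mb := mb)
    rw [Nat.cast_max] at this
    rcases le_total (nb : ℝ) f with hle | hle
    · rw [max_eq_right hle] at this
      rw [max_eq_right (by linarith)]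
      linarith
    · rw [max_eq_left hle] at this
      rw [max_eq_left (by linarith)]
      linarith
  · rw [max_eq_left (by omega), Nat.sub_eq_zero_of_le (by omega)] at hmax
    simpa using hmax
end

section
/- Inner bound (Theorem 2): For the deterministic two-hop interference channel with parameters (n, m, f, n̄, m̄), the sum capacity C_sum satisfies: if 3m ≤ 2n then C_sum ≥ min{2·max(n−m, m) + 2m̄, 2n − m, 2f}; if 2n ≤ 3m and m ≤ 2n then C_sum ≥ min{max(2n−m, m), 2f}; and if m ≥ 2n then C_sum ≥ min{n + f + (n̄ − f)⁺, 2n + 2n̄, m, 2f}. -/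
open scoped Classical

namespace TwoHopIC

/-! ### Realising a family of signals by a code -/

/-- The level sequence `x` moved down by `k` levels. -/
def down (k : ℕ) (x : ℕ → ZMod 2) (l : ℕ) : ZMod 2 := if k ≤ l then x (l - k) else 0

/-- The vector of the top `q` levels of `x`. -/
def topLevels (q : ℕ) (x : ℕ → ZMod 2) : Fin q → ZMod 2 := fun l => x l

theorem topLevels_eq_iff {q : ℕ} {x y : ℕ → ZMod 2} :
    topLevels q x = topLevels q y ↔ ∀ l < q, x l = y l :=
  ⟨fun h l hl => congrFun h ⟨l, hl⟩, fun h => funext fun l => h l l.2⟩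

theorem shiftMat_mulVec_topLevels (q k : ℕ) (x : ℕ → ZMod 2) :
    (shiftMat q k).mulVec (topLevels q x) = topLevels q (down k x) := by
  funext i
  simp only [Matrix.mulVec, dotProduct, shiftMat, Matrix.of_apply, topLevels, down, ite_mul,
    one_mul, zero_mul]
  split_ifs with h
  · rw [Finset.sum_eq_single ⟨(i : ℕ) - k, by omega⟩]
    · simp [Nat.sub_add_cancel h]
    · intro b _ hb
      rw [if_neg]
      intro hi
      exact hb (Fin.ext (by simp; omega))
    · simp
  · exact Finset.sum_eq_zero fun b _ => if_neg (by omega)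

/-- What relay `i` hears when the sources send `X`. -/
def hearR (n m : ℕ) (X : Bool → ℕ → ZMod 2) (i : Bool) (l : ℕ) : ZMod 2 :=
  down (max m n - n) (X i) l + down (max m n - m) (X (!i)) l

/-- What source `i` overhears when the relays send `X`. -/
def hearS (f nb mb : ℕ) (X : Bool → ℕ → ZMod 2) (i : Bool) (l : ℕ) : ZMod 2 :=
  down (max mb (max nb f) - nb) (X i) l + down (max mb (max nb f) - mb) (X (!i)) l

/-- The messages of user `i` in two message pairs coincide. -/
def SameMsg {M1 M2 : ℕ} (i : Bool) (w w' : Fin M1 × Fin M2) : Prop :=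
  if i then w.2 = w'.2 else w.1 = w'.1

section Realize

variable {n m f nb mb N M1 M2 : ℕ}

/-- A map sending every value `g w` to `h w`, provided `h` factors through `g`. -/
theorem exists_factor {α β γ : Type*} [Inhabited γ] (g : α → β) (h : α → γ)
    (hgh : ∀ w w', g w = g w' → h w = h w') : ∃ e : β → γ, ∀ w, e (g w) = h w :=
  ⟨Function.extend g h default, fun w =>
    Function.FactorsThrough.extend_apply (fun a b hab => hgh a b hab) _ w⟩

theorem exists_code_errProb_eq_zero (w₀ : Fin M1 × Fin M2)
    (XS XR : Fin M1 × Fin M2 → ℕ → Bool → ℕ → ZMod 2)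
    (hS : ∀ i w w' t, SameMsg i w w' →
      (∀ s < t, ∀ l < max mb (max nb f),
        hearS f nb mb (XR w s) i l = hearS f nb mb (XR w' s) i l) →
      ∀ l < max m n, XS w t i l = XS w' t i l)
    (hR : ∀ i w w' t,
      (∀ s < t, ∀ l < max m n, hearR n m (XS w s) i l = hearR n m (XS w' s) i l) →
      ∀ l < max mb (max nb f), XR w t i l = XR w' t i l)
    (hD : ∀ i w w', (∀ t < N, ∀ l < f, XR w t i l = XR w' t i l) → SameMsg i w w') :
    ∃ C : Code n m f nb mb N M1 M2, errProb C = 0 := by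
  set q := max m n with hq
  set p := max mb (max nb f) with hp
  have encS1 : ∀ t : ℕ, ∃ e : Fin M1 × (Fin t → Fin p → ZMod 2) → (Fin q → ZMod 2),
      ∀ w : Fin M1 × Fin M2, e (w.1, fun s => topLevels p (hearS f nb mb (XR w s) false)) =
        topLevels q (XS w t false) := by
    intro t
    apply exists_factor (fun w : Fin M1 × Fin M2 =>
      (w.1, fun s : Fin t => topLevels p (hearS f nb mb (XR w s) false)))
    intro w w' h
    rw [Prod.mk.injEq] at h
    rw [topLevels_eq_iff]
    exact hS false w w' t (by simpa [SameMsg] using h.1)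
      fun s hs => topLevels_eq_iff.1 (congrFun h.2 ⟨s, hs⟩)
  have encS2 : ∀ t : ℕ, ∃ e : Fin M2 × (Fin t → Fin p → ZMod 2) → (Fin q → ZMod 2),
      ∀ w : Fin M1 × Fin M2, e (w.2, fun s => topLevels p (hearS f nb mb (XR w s) true)) =
        topLevels q (XS w t true) := by
    intro t
    apply exists_factor (fun w : Fin M1 × Fin M2 =>
      (w.2, fun s : Fin t => topLevels p (hearS f nb mb (XR w s) true)))
    intro w w' h
    rw [Prod.mk.injEq] at h
    rw [topLevels_eq_iff]
    exact hS true w w' t (by simpa [SameMsg] using h.1)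
      fun s hs => topLevels_eq_iff.1 (congrFun h.2 ⟨s, hs⟩)
  have encR : ∀ (i : Bool) (t : ℕ), ∃ e : (Fin t → Fin q → ZMod 2) → (Fin p → ZMod 2),
      ∀ w : Fin M1 × Fin M2, e (fun s => topLevels q (hearR n m (XS w s) i)) =
        topLevels p (XR w t i) := by
    intro i t
    apply exists_factor (fun w : Fin M1 × Fin M2 =>
      fun s : Fin t => topLevels q (hearR n m (XS w s) i))
    intro w w' h
    rw [topLevels_eq_iff]
    exact hR i w w' t fun s hs => topLevels_eq_iff.1 (congrFun h ⟨s, hs⟩)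
  have hdest : ∀ i (w w' : Fin M1 × Fin M2),
      (fun t : Fin N => topLevels p (down (p - f) (XR w t i))) =
        (fun t : Fin N => topLevels p (down (p - f) (XR w' t i))) → SameMsg i w w' := by
    intro i w w' h
    refine hD i w w' fun t ht l hl => ?_
    have hfp : f ≤ p := by omega
    have := topLevels_eq_iff.1 (congrFun h ⟨t, ht⟩) (l + (p - f)) (by omega)
    simpa [down] using this
  have : Inhabited (Fin M1) := ⟨w₀.1⟩
  have : Inhabited (Fin M2) := ⟨w₀.2⟩
  obtain ⟨d1, hd1⟩ := exists_factor
    (fun (w : Fin M1 × Fin M2) (t : Fin N) => topLevels p (down (p - f) (XR w t false)))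
    (fun w => w.1) (fun w w' h => by simpa [SameMsg] using hdest false w w' h)
  obtain ⟨d2, hd2⟩ := exists_factor
    (fun (w : Fin M1 × Fin M2) (t : Fin N) => topLevels p (down (p - f) (XR w t true)))
    (fun w => w.2) (fun w w' h => by simpa [SameMsg] using hdest true w w' h)
  choose eS1 heS1 using encS1
  choose eS2 heS2 using encS2
  choose eR heR using encR
  let C : Code n m f nb mb N M1 M2 :=
    { encS1 := fun t a y => eS1 t (a, y)
      encS2 := fun t a y => eS2 t (a, y)
      encR1 := fun t y => eR false t y
      encR2 := fun t y => eR true t y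
      dec1 := d1
      dec2 := d2 }
  have relay1 : ∀ w {t : ℕ} (h : Fin t → FSig n m × FSig n m) (_ : ∀ s, h s =
      (topLevels q (XS w s false), topLevels q (XS w s true))) (s : Fin t),
      relayTx1 C h s = topLevels p (XR w s false) := by
    intro w t h hh s
    rw [← heR false s w]
    change eR false s _ = _
    congr 1
    funext u
    simp only [relayRx1, hh]
    exact congrArg₂ (· + ·) (shiftMat_mulVec_topLevels _ _ _) (shiftMat_mulVec_topLevels _ _ _)
  have relay2 : ∀ w {t : ℕ} (h : Fin t → FSig n m × FSig n m) (_ : ∀ s, h s =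
      (topLevels q (XS w s false), topLevels q (XS w s true))) (s : Fin t),
      relayTx2 C h s = topLevels p (XR w s true) := by
    intro w t h hh s
    rw [← heR true s w]
    change eR true s _ = _
    congr 1
    funext u
    simp only [relayRx2, hh]
    rw [add_comm]
    exact congrArg₂ (· + ·) (shiftMat_mulVec_topLevels _ _ _) (shiftMat_mulVec_topLevels _ _ _)
  have hist : ∀ (w : Fin M1 × Fin M2) (t : ℕ) (s : Fin t), srcHist C w.1 w.2 t s =
      (topLevels q (XS w s false), topLevels q (XS w s true)) := by
    intro w t
    induction t with
    | zero => exact fun s => s.elim0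
    | succ t ih =>
      intro s
      refine Fin.lastCases ?_ (fun s => ?_) s
      · simp only [srcHist, Fin.snoc_last, Fin.val_last]
        rw [Prod.mk.injEq]
        constructor
        · rw [← heS1 t w]
          change eS1 t _ = _
          congr 2
          funext s
          simp only [srcRx1, relay1 w _ ih, relay2 w _ ih]
          exact congrArg₂ (· + ·) (shiftMat_mulVec_topLevels _ _ _)
            (shiftMat_mulVec_topLevels _ _ _)
        · rw [← heS2 t w]
          change eS2 t _ = _
          congr 2
          funext s
          simp only [srcRx2, relay1 w _ ih, relay2 w _ ih]
          exact congrArg₂ (· + ·) (shiftMat_mulVec_topLevels _ _ _)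
            (shiftMat_mulVec_topLevels _ _ _)
      · simp only [srcHist, Fin.snoc_castSucc, Fin.val_castSucc]
        exact ih s
  refine ⟨C, ?_⟩
  have h1 : ∀ w : Fin M1 × Fin M2, C.dec1 (fun t => destRx1 C w.1 w.2 t.val) = w.1 := by
    intro w
    refine Eq.trans (congrArg d1 ?_) (hd1 w)
    funext t
    simp only [destRx1, relayTxAt1, relay1 w _ (hist w _)]
    exact shiftMat_mulVec_topLevels _ _ _
  have h2 : ∀ w : Fin M1 × Fin M2, C.dec2 (fun t => destRx2 C w.1 w.2 t.val) = w.2 := by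
    intro w
    refine Eq.trans (congrArg d2 ?_) (hd2 w)
    funext t
    simp only [destRx2, relayTxAt2, relay2 w _ (hist w _)]
    exact shiftMat_mulVec_topLevels _ _ _
  simp [errProb, h1, h2]

end Realize

/-! ### The set of achievable sum rates is bounded -/

section Bounded

variable {n m f nb mb N M1 M2 : ℕ}

theorem card_le_of_errProb_le_half (C : Code n m f nb mb N M1 M2) (hM1 : 0 < M1) (hM2 : 0 < M2)
    (hC : errProb C ≤ 1 / 2) :
    M1 ≤ 2 * 2 ^ (N * max mb (max nb f)) ∧ M2 ≤ 2 * 2 ^ (N * max mb (max nb f)) := by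
  classical
  set p := max mb (max nb f) with hp
  set bad := Finset.univ.filter fun w : Fin M1 × Fin M2 =>
      C.dec1 (fun t => destRx1 C w.1 w.2 t.val) ≠ w.1 ∨
      C.dec2 (fun t => destRx2 C w.1 w.2 t.val) ≠ w.2 with hbad
  have hpos : (0 : ℝ) < (M1 : ℝ) * M2 := by positivity
  have hbad' : 2 * bad.card ≤ M1 * M2 := by
    have h : (bad.card : ℝ) / ((M1 : ℝ) * M2) ≤ 1 / 2 := by
      rw [hbad]; convert hC using 1; simp only [errProb]
    rw [div_le_iff₀ hpos] at h
    have : (2 * bad.card : ℝ) ≤ M1 * M2 := by linarith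
    exact_mod_cast this
  have hcompl : badᶜ.card + bad.card = M1 * M2 := by
    rw [Finset.card_compl_add_card]; simp
  have hcard : Fintype.card (Fin N → BSig f nb mb) = 2 ^ (N * p) := by
    simp [← hp, ← pow_mul, mul_comm]
  have himg1 : (Finset.univ.image C.dec1).card ≤ 2 ^ (N * p) :=
    Finset.card_image_le.trans (by rw [Finset.card_univ, hcard])
  have himg2 : (Finset.univ.image C.dec2).card ≤ 2 ^ (N * p) :=
    Finset.card_image_le.trans (by rw [Finset.card_univ, hcard])
  have hgood : ∀ w ∈ badᶜ, C.dec1 (fun t => destRx1 C w.1 w.2 t.val) = w.1 ∧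
      C.dec2 (fun t => destRx2 C w.1 w.2 t.val) = w.2 := by
    intro w hw
    simpa [hbad] using hw
  have h1 : badᶜ.card ≤ 2 ^ (N * p) * M2 := by
    have hsub : badᶜ ⊆ (Finset.univ.image C.dec1) ×ˢ (Finset.univ : Finset (Fin M2)) := by
      intro w hw
      rw [Finset.mem_product]
      exact ⟨Finset.mem_image.2 ⟨_, Finset.mem_univ _, (hgood w hw).1⟩, Finset.mem_univ _⟩
    refine (Finset.card_le_card hsub).trans ?_
    rw [Finset.card_product, Finset.card_univ, Fintype.card_fin]
    exact Nat.mul_le_mul_right _ himg1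
  have h2 : badᶜ.card ≤ 2 ^ (N * p) * M1 := by
    have hsub : badᶜ ⊆ (Finset.univ : Finset (Fin M1)) ×ˢ (Finset.univ.image C.dec2) := by
      intro w hw
      rw [Finset.mem_product]
      exact ⟨Finset.mem_univ _, Finset.mem_image.2 ⟨_, Finset.mem_univ _, (hgood w hw).2⟩⟩
    refine (Finset.card_le_card hsub).trans ?_
    rw [Finset.card_product, Finset.card_univ, Fintype.card_fin, mul_comm]
    exact Nat.mul_le_mul_right _ himg2
  constructor
  · refine Nat.le_of_mul_le_mul_right (c := M2) ?_ hM2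
    nlinarith
  · refine Nat.le_of_mul_le_mul_right (c := M1) ?_ hM1
    nlinarith

theorem rate_le_of_ceil_le {p : ℕ} {R : ℝ} (hN : 0 < N)
    (h : ⌈(2 : ℝ) ^ ((N : ℝ) * R)⌉₊ ≤ 2 * 2 ^ (N * p)) : R ≤ p + 1 := by
  have h' : (2 : ℝ) ^ ((N : ℝ) * R) ≤ (2 : ℝ) ^ ((N * p + 1 : ℕ) : ℝ) := by
    refine (Nat.le_ceil _).trans ?_
    rw [Real.rpow_natCast, pow_succ]
    exact_mod_cast h.trans_eq (mul_comm _ _)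
  rw [Real.rpow_le_rpow_left_iff one_lt_two] at h'
  push_cast at h'
  have hN' : (1 : ℝ) ≤ N := by exact_mod_cast hN
  by_contra! hR
  nlinarith

theorem bddAbove_sumRates (n m f nb mb : ℕ) :
    BddAbove {r : ℝ | ∃ R1 R2 : ℝ, Achievable n m f nb mb R1 R2 ∧ r = R1 + R2} := by
  refine ⟨2 * ((max mb (max nb f) : ℕ) + 1), ?_⟩
  rintro _ ⟨R1, R2, ⟨-, -, h⟩, rfl⟩
  obtain ⟨N, hN, C, hC⟩ := h (1 / 2) (by norm_num)
  have hpos : ∀ R : ℝ, 0 < ⌈(2 : ℝ) ^ ((N : ℝ) * R)⌉₊ := fun R => Nat.ceil_pos.2 (by positivity)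
  obtain ⟨h1, h2⟩ := card_le_of_errProb_le_half C (hpos _) (hpos _) hC
  have := rate_le_of_ceil_le hN h1
  have := rate_le_of_ceil_le hN h2
  linarith

end Bounded

/-! ### Streaming schemes -/

/-- A streaming scheme. User `i` sends the bits `w i t l`, `l < r i`, in slot `t`, where slot `0`
carries no data; `XS w t i` and `XR w t i` are the signals of source `i` and relay `i` in slot `t`.
Every destination knows the data of a slot within four further slots. -/
structure IsScheme (n m f nb mb : ℕ) (r : Bool → ℕ)
    (XS XR : (Bool → ℕ → ℕ → ZMod 2) → ℕ → Bool → ℕ → ZMod 2) : Prop where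
  source : ∀ i w w' t, (∀ j, w j 0 = 0) → (∀ j, w' j 0 = 0) → w i = w' i →
    (∀ s < t, ∀ l < max mb (max nb f),
      hearS f nb mb (XR w s) i l = hearS f nb mb (XR w' s) i l) →
    ∀ l < max m n, XS w t i l = XS w' t i l
  relay : ∀ i w w' t, (∀ j, w j 0 = 0) → (∀ j, w' j 0 = 0) →
    (∀ s < t, ∀ l < max m n, hearR n m (XS w s) i l = hearR n m (XS w' s) i l) →
    ∀ l < max mb (max nb f), XR w t i l = XR w' t i l
  dest : ∀ i w w' T, (∀ j, w j 0 = 0) → (∀ j, w' j 0 = 0) →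
    (∀ t < T + 4, ∀ l < f, XR w t i l = XR w' t i l) →
    ∀ t ≤ T, ∀ l < r i, w i t l = w' i t l

/-- The bit stream carrying the array `a` in slots `1, …, T`. -/
def stream {T r : ℕ} (a : Fin T → Fin r → ZMod 2) (t l : ℕ) : ZMod 2 :=
  if h : (1 ≤ t ∧ t ≤ T) ∧ l < r then a ⟨t - 1, by omega⟩ ⟨l, h.2⟩ else 0

theorem stream_zero {T r : ℕ} (a : Fin T → Fin r → ZMod 2) : stream a 0 = 0 := by
  funext l
  simp [stream]

theorem eq_of_stream_eq {T r : ℕ} {a b : Fin T → Fin r → ZMod 2}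
    (h : ∀ t ≤ T, ∀ l < r, stream a t l = stream b t l) : a = b := by
  funext t l
  have := h (t + 1) (by omega) l l.2
  simpa [stream, Nat.succ_le_iff, t.2] using this

theorem IsScheme.achievable {n m f nb mb : ℕ} {r : Bool → ℕ}
    {XS XR : (Bool → ℕ → ℕ → ZMod 2) → ℕ → Bool → ℕ → ZMod 2}
    (h : IsScheme n m f nb mb r XS XR) (T : ℕ) :
    Achievable n m f nb mb ((T * r false : ℕ) / (T + 4 : ℕ)) ((T * r true : ℕ) / (T + 4 : ℕ)) := by
  refine ⟨by positivity, by positivity, fun ε hε => ⟨T + 4, by omega, ?_⟩⟩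
  have hM : ∀ k : ℕ, ⌈(2 : ℝ) ^ (((T + 4 : ℕ) : ℝ) * ((k : ℝ) / (T + 4 : ℕ)))⌉₊ = 2 ^ k := by
    intro k
    rw [mul_div_cancel₀ _ (by positivity), Real.rpow_natCast]
    exact_mod_cast Nat.ceil_natCast (2 ^ k)
  rw [hM, hM]
  have hcard : ∀ k, Fintype.card (Fin T → Fin k → ZMod 2) = 2 ^ (T * k) := by
    intro k
    simp [← pow_mul, mul_comm]
  let e (k : ℕ) : Fin (2 ^ (T * k)) ≃ (Fin T → Fin k → ZMod 2) :=
    (Fintype.equivFinOfCardEq (hcard k)).symm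
  let W (w : Fin (2 ^ (T * r false)) × Fin (2 ^ (T * r true))) (i : Bool) : ℕ → ℕ → ZMod 2 :=
    if i then stream (e _ w.2) else stream (e _ w.1)
  have hW0 : ∀ w j, W w j 0 = 0 := by
    intro w j
    cases j <;> simp [W, stream_zero]
  have hW : ∀ i w w', SameMsg i w w' → W w i = W w' i := by
    intro i w w' hw
    cases i <;> simp [W, SameMsg] at hw ⊢ <;> rw [hw]
  obtain ⟨C, hC⟩ := exists_code_errProb_eq_zero (n := n) (m := m) (f := f) (nb := nb) (mb := mb)
    (N := T + 4) (⟨0, by positivity⟩, ⟨0, by positivity⟩)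
    (fun w => XS (W w)) (fun w => XR (W w))
    (fun i w w' t hw => h.source i _ _ t (hW0 w) (hW0 w') (hW i w w' hw))
    (fun i w w' t => h.relay i _ _ t (hW0 w) (hW0 w'))
    (fun i w w' hD => by
      have := h.dest i _ _ T (hW0 w) (hW0 w') hD
      cases i
      · exact (e _).injective (eq_of_stream_eq (by simpa [W] using this))
      · exact (e _).injective (eq_of_stream_eq (by simpa [W] using this)))
  exact ⟨C, hC.le.trans hε.le⟩

theorem IsScheme.le_sumCapacity {n m f nb mb : ℕ} {r : Bool → ℕ}
    {XS XR : (Bool → ℕ → ℕ → ZMod 2) → ℕ → Bool → ℕ → ZMod 2}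
    (h : IsScheme n m f nb mb r XS XR) :
    ((r false + r true : ℕ) : ℝ) ≤ sumCapacity n m f nb mb := by
  have key : ∀ T : ℕ, (r false + r true : ℕ) * ((T : ℝ) / (T + 4)) ≤ sumCapacity n m f nb mb := by
    intro T
    refine le_csSup (bddAbove_sumRates n m f nb mb) ⟨_, _, h.achievable T, ?_⟩
    push_cast
    ring
  have hlim : Filter.Tendsto (fun T : ℕ => (T : ℝ) / (T + 4)) Filter.atTop (nhds 1) :=
    tendsto_natCast_div_add_atTop 4
  have := hlim.const_mul ((r false + r true : ℕ) : ℝ)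
  rw [mul_one] at this
  exact le_of_tendsto this (Filter.Eventually.of_forall key)

/-! ### Weak interference: cooperation through the overheard cross link -/

section Weak

/-- Source signals for weak interference. Levels `k, …, k + e i - 1` carry fresh bits which the
other source overhears and repeats on its next levels two slots later. -/
def weakS (n m k : ℕ) (e : Bool → ℕ) (w : Bool → ℕ → ℕ → ZMod 2) (t : ℕ) (i : Bool) (l : ℕ) :
    ZMod 2 :=
  if l < k then w i t (e i + l)
  else if l < k + e i then w i t (l - k)
  else if l < k + e i + e (!i) then w (!i) (t - 2) (l - k - e i)
  else if m ≤ l ∧ l < n then w i t (e i + k + (l - m))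
  else 0

/-- Relay signals for weak interference. -/
def weakR (e r : Bool → ℕ) (w : Bool → ℕ → ℕ → ZMod 2) (t : ℕ) (i : Bool) (l : ℕ) : ZMod 2 :=
  if l < e i then w i (t - 1) l else if l < r i then w i (t - 3) l else 0

variable {n m f nb mb k : ℕ} {e r : Bool → ℕ} {w w' : Bool → ℕ → ℕ → ZMod 2}

theorem hearR_of_le (hmn : m ≤ n) (X : Bool → ℕ → ZMod 2) (i : Bool) (l : ℕ) :
    hearR n m X i l = X i l + down (n - m) (X (!i)) l := by
  simp [hearR, down, max_eq_right hmn]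

theorem weakS_of_hearR_eq (hmn : m ≤ n) (hk : 2 * m ≤ n + k) {i : Bool} {s : ℕ}
    (h : ∀ l < n, hearR n m (weakS n m k e w s) i l = hearR n m (weakS n m k e w' s) i l)
    {l : ℕ} (hl : l < m - k) : weakS n m k e w s i l = weakS n m k e w' s i l := by
  have := h l (by omega)
  simpa [hearR_of_le hmn, down, show ¬ (n - m ≤ l) by omega] using this

theorem weak_public_eq (hmn : m ≤ n) (hk : 2 * m ≤ n + k)
    (hke : 2 * k + e false + e true ≤ m) {i : Bool} {s : ℕ}
    (h : ∀ l < n, hearR n m (weakS n m k e w s) i l = hearR n m (weakS n m k e w' s) i l) :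
    (∀ j < e i + k, w i s j = w' i s j) ∧ ∀ j < e (!i), w (!i) (s - 2) j = w' (!i) (s - 2) j := by
  have hsum : e i + e (!i) = e false + e true := by cases i <;> simp [add_comm]
  refine ⟨fun j hj => ?_, fun j hj => ?_⟩
  · by_cases hji : j < e i
    · have := weakS_of_hearR_eq hmn hk h (l := k + j) (by omega)
      simpa [weakS, hji] using this
    · have := weakS_of_hearR_eq hmn hk h (l := j - e i) (by omega)
      simpa [weakS, show j - e i < k by omega, show e i + (j - e i) = j by omega] using this
  · have := weakS_of_hearR_eq hmn hk h (l := k + e i + j) (by omega)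
    simpa [weakS, hj, show ¬ (k + e i + j < k) by omega, show ¬ (k + e i + j < k + e i) by omega,
      show k + e i + j - k - e i = j by omega] using this

theorem weak_all_eq (hmn : m ≤ n) (hk : 2 * m ≤ n + k) (hk' : n + k ≤ 2 * m ∨ k = 0)
    (hke : 2 * k + e false + e true ≤ m) {i : Bool} {t : ℕ}
    (h : ∀ s ≤ t + 2, ∀ l < n,
      hearR n m (weakS n m k e w s) i l = hearR n m (weakS n m k e w' s) i l) :
    ∀ j < e i + k + (n - m), w i t j = w' i t j := by
  intro j hj
  have hsum : e i + e (!i) = e false + e true := by cases i <;> simp [add_comm]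
  have hpub := fun s hs => weak_public_eq hmn hk hke (h s hs)
  by_cases hji : j < e i + k
  · exact (hpub t (by omega)).1 j hji
  obtain ⟨d, rfl⟩ : ∃ d, j = e i + k + d := ⟨j - (e i + k), by omega⟩
  have hX : ∀ v : Bool → ℕ → ℕ → ZMod 2, weakS n m k e v t i (m + d) = v i t (e i + k + d) := by
    intro v
    simp [weakS, show ¬ (m + d < k) by omega, show ¬ (m + d < k + e i) by omega,
      show ¬ (m + d < k + e i + e (!i)) by omega, show m + d < n by omega]
  have hI : down (n - m) (weakS n m k e w t (!i)) (m + d) =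
      down (n - m) (weakS n m k e w' t (!i)) (m + d) := by
    unfold down
    split_ifs with hl
    · set l := m + d - (n - m) with hl'
      have hlk : ¬ l < k := by omega
      have hlm : ¬ m ≤ l := by omega
      simp only [weakS, if_neg hlk, hlm, false_and, if_false, Bool.not_not]
      split_ifs with h1 h2
      · simpa using (hpub (t + 2) le_rfl).2 (l - k) (by omega)
      · exact (hpub (t - 2) (by omega)).1 _ (by omega)
      · rfl
    · rfl
  have := h t (by omega) (m + d) (by omega)
  rw [hearR_of_le hmn, hearR_of_le hmn, hI, hX, hX] at this
  exact add_right_cancel this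

theorem isScheme_weak (hmn : m ≤ n) (hk : 2 * m ≤ n + k) (hk' : n + k ≤ 2 * m ∨ k = 0)
    (hke : 2 * k + e false + e true ≤ m) (hemb : ∀ i, e i ≤ mb)
    (her : ∀ i, e i ≤ r i) (hr : ∀ i, r i ≤ e i + k + (n - m)) (hrf : ∀ i, r i ≤ f) :
    IsScheme n m f nb mb r (weakS n m k e) (weakR e r) where
  source := by
    intro i w w' t hw hw' hi h l _
    have hd : ∀ j < e (!i), w (!i) (t - 2) j = w' (!i) (t - 2) j := by
      intro j hj
      rcases Nat.eq_zero_or_pos t with rfl | ht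
      · simp [hw, hw']
      have hmb := hemb (!i)
      have := h (t - 1) (by omega) (max mb (max nb f) - mb + j) (by omega)
      have hX : ∀ l, weakR e r w (t - 1) i l = weakR e r w' (t - 1) i l := by
        intro l
        simp [weakR, hi]
      simp only [hearS, down, hX] at this
      simpa [weakR, hj, Nat.sub_sub] using this
    simp only [weakS, hi]
    split_ifs with h1 h2 h3 <;> first | rfl | exact hd _ (by omega)
  relay := by
    intro i w w' t hw hw' h l _
    rw [max_eq_right hmn] at h
    have he := her i
    unfold weakR
    split_ifs with h1 h2
    · rcases Nat.eq_zero_or_pos t with rfl | ht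
      · simp [hw, hw']
      exact (weak_public_eq hmn hk hke (h (t - 1) (by omega))).1 l (by omega)
    · by_cases ht : t ≤ 3
      · simp [show t - 3 = 0 by omega, hw, hw']
      exact weak_all_eq hmn hk hk' hke (fun s hs => h s (by omega)) l (h2.trans_le (hr i))
    · rfl
  dest := by
    intro i w w' T _ _ h t ht l hl
    have hf := hrf i
    by_cases hle : l < e i
    · simpa [weakR, hle] using h (t + 1) (by omega) l (by omega)
    · simpa [weakR, hle, hl] using h (t + 3) (by omega) l (by omega)

end Weak

/-! ### Strong interference: cooperation through the overheard direct link -/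

section Strong

/-- Source signals for strong interference. Levels `n, …, n + e i - 1` carry fresh bits which reach
relay `i` through the other source, two slots later. -/
def strongS (n : ℕ) (e : Bool → ℕ) (w : Bool → ℕ → ℕ → ZMod 2) (t : ℕ) (i : Bool) (l : ℕ) :
    ZMod 2 :=
  if l < n then w i t (e i + l)
  else if l < n + e i then w i t (l - n)
  else if l < n + e i + e (!i) then w (!i) (t - 2) (l - n - e i)
  else 0

/-- The `j`-th data bit which relay `i` forwards in slot `t`. -/
def strongData (e : Bool → ℕ) (w : Bool → ℕ → ℕ → ZMod 2) (t : ℕ) (i : Bool) (j : ℕ) : ZMod 2 :=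
  if j < e i then w i (t - 3) j else w i (t - 1) j

/-- The part of the signal of relay `i` carrying data, on the levels from `a i` on. -/
def strongRData (a e r : Bool → ℕ) (w : Bool → ℕ → ℕ → ZMod 2) (t : ℕ) (i : Bool) (l : ℕ) :
    ZMod 2 :=
  if a i ≤ l ∧ l < a i + r i then strongData e w t i (l - a i) else 0

/-- Relay signals for strong interference: data on the levels from `a i` on, and feedback to source
`i` on the levels from `b i` on, from which the data of the other relay is precancelled. -/
def strongR (p nb mb : ℕ) (a b e r : Bool → ℕ) (w : Bool → ℕ → ℕ → ZMod 2) (t : ℕ) (i : Bool)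
    (l : ℕ) : ZMod 2 :=
  if b i ≤ l ∧ l < b i + e (!i) then
    w (!i) (t - 1) (l - b i) + down (p - mb) (strongRData a e r w t (!i)) (l + (p - nb))
  else strongRData a e r w t i l

variable {n m f nb mb : ℕ} {a b e r : Bool → ℕ} {w w' : Bool → ℕ → ℕ → ZMod 2}

theorem hearR_of_ge (hnm : n ≤ m) (X : Bool → ℕ → ZMod 2) (i : Bool) (l : ℕ) :
    hearR n m X i l = down (m - n) (X i) l + X (!i) l := by
  simp [hearR, down, max_eq_left hnm]

theorem strong_eq_of_hearR_eq (hm : 2 * n + e false + e true ≤ m) {i : Bool} {s : ℕ}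
    (h : ∀ l < m, hearR n m (strongS n e w s) i l = hearR n m (strongS n e w' s) i l) :
    (∀ j < e (!i) + n, w (!i) s j = w' (!i) s j) ∧ (∀ j < e i, w i (s - 2) j = w' i (s - 2) j) ∧
      ∀ j < e i + n, e i ≤ j → w i s j = w' i s j := by
  have hsum : e i + e (!i) = e false + e true := by cases i <;> simp [add_comm]
  have hX : ∀ l < m - n, strongS n e w s (!i) l = strongS n e w' s (!i) l := by
    intro l hl
    have := h l (by omega)
    simpa [hearR_of_ge (show n ≤ m by omega), down, show ¬ (m - n ≤ l) by omega] using this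
  refine ⟨fun j hj => ?_, fun j hj => ?_, fun j hj hji => ?_⟩
  · by_cases hji : j < e (!i)
    · simpa [strongS, hji] using hX (n + j) (by omega)
    · simpa [strongS, show j - e (!i) < n by omega, show e (!i) + (j - e (!i)) = j by omega]
        using hX (j - e (!i)) (by omega)
  · simpa [strongS, hj, show ¬ (n + e (!i) + j < n) by omega,
      show ¬ (n + e (!i) + j < n + e (!i)) by omega,
      show n + e (!i) + j - n - e (!i) = j by omega] using hX (n + e (!i) + j) (by omega)
  · have h0 : ∀ v : Bool → ℕ → ℕ → ZMod 2, strongS n e v s (!i) (m - n + (j - e i)) = 0 := by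
      intro v
      simp [strongS, show ¬ (m - n + (j - e i) < n) by omega,
        show ¬ (m - n + (j - e i) < n + e (!i)) by omega,
        show ¬ (m - n + (j - e i) < n + e (!i) + e i) by omega]
    have := h (m - n + (j - e i)) (by omega)
    rw [hearR_of_ge (by omega), hearR_of_ge (by omega), h0, h0] at this
    simpa [down, strongS, show j - e i < n by omega,
      show e i + (j - e i) = j by omega] using this

theorem strongRData_congr {t : ℕ} {i : Bool} (h : ∀ j < r i, strongData e w t i j =
    strongData e w' t i j) (l : ℕ) : strongRData a e r w t i l = strongRData a e r w' t i l := by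
  unfold strongRData
  split_ifs with hl
  · exact h _ (by omega)
  · rfl

theorem down_congr {x y : ℕ → ZMod 2} (h : ∀ l, x l = y l) (d l : ℕ) : down d x l = down d y l := by
  rw [funext h]

theorem isScheme_strong (hm : 2 * n + e false + e true ≤ m) (hbnb : ∀ i, b i + e (!i) ≤ nb)
    (haf : ∀ i, a i + r i ≤ f) (hab : ∀ i, a i + r i ≤ b i ∨ b i + e (!i) ≤ a i)
    (hr : ∀ i, r i ≤ e i + n) :
    IsScheme n m f nb mb r (strongS n e) (strongR (max mb (max nb f)) nb mb a b e r) where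
  source := by
    intro i w w' t hw hw' hi h l _
    set p := max mb (max nb f) with hp
    have hd : ∀ j < e (!i), w (!i) (t - 2) j = w' (!i) (t - 2) j := by
      intro j hj
      rcases Nat.eq_zero_or_pos t with rfl | ht
      · simp [hw, hw']
      have hb := hbnb i
      have hlev := h (t - 1) (by omega) (b i + j + (p - nb)) (by omega)
      have hown : ∀ l, strongRData a e r w (t - 1) i l = strongRData a e r w' (t - 1) i l := by
        intro l
        simp [strongRData, strongData, hi]
      have hdir : ∀ v : Bool → ℕ → ℕ → ZMod 2,
          down (p - nb) (strongR p nb mb a b e r v (t - 1) i) (b i + j + (p - nb)) =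
            v (!i) (t - 2) j + down (p - mb) (strongRData a e r v (t - 1) (!i))
              (b i + j + (p - nb)) := by
        intro v
        simp [down, strongR, hj, Nat.sub_sub]
      have hcross : ∀ l, strongR p nb mb a b e r w (t - 1) (!i) l -
            strongRData a e r w (t - 1) (!i) l =
          strongR p nb mb a b e r w' (t - 1) (!i) l -
            strongRData a e r w' (t - 1) (!i) l := by
        intro l
        unfold strongR
        split_ifs with hl
        · have hz : ∀ v : Bool → ℕ → ℕ → ZMod 2, strongRData a e r v (t - 1) (!i) l = 0 := by
            intro v
            have := hab (!i)
            exact if_neg (by omega)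
          rw [hz, hz, Bool.not_not, hi, down_congr hown]
        · simp
      have hcross' : down (p - mb) (strongR p nb mb a b e r w (t - 1) (!i)) (b i + j + (p - nb)) -
            down (p - mb) (strongRData a e r w (t - 1) (!i)) (b i + j + (p - nb)) =
          down (p - mb) (strongR p nb mb a b e r w' (t - 1) (!i)) (b i + j + (p - nb)) -
            down (p - mb) (strongRData a e r w' (t - 1) (!i)) (b i + j + (p - nb)) := by
        unfold down
        split_ifs
        · exact hcross _
        · rfl
      simp only [hearS, ← hp, hdir] at hlev
      have h2 : ∀ x : ZMod 2, x + x = 0 := CharTwo.add_self_eq_zero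
      linear_combination hlev - hcross' -
        h2 (down (p - mb) (strongRData a e r w (t - 1) (!i)) (b i + j + (p - nb))) +
        h2 (down (p - mb) (strongRData a e r w' (t - 1) (!i)) (b i + j + (p - nb)))
    simp only [strongS, hi]
    split_ifs with h1 h2 h3 <;> first | rfl | exact hd _ (by omega)
  relay := by
    intro i w w' t hw hw' h l _
    rw [max_eq_left (by omega)] at h
    have hK := fun s hs => strong_eq_of_hearR_eq hm (h s hs)
    have hown : ∀ j < r i, strongData e w t i j = strongData e w' t i j := by
      intro j hj
      have := hr i
      rcases Nat.eq_zero_or_pos t with rfl | ht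
      · simp [strongData, hw, hw']
      unfold strongData
      split_ifs with hji
      · simpa [Nat.sub_sub] using (hK (t - 1) (by omega)).2.1 j hji
      · exact (hK (t - 1) (by omega)).2.2 j (by omega) (by omega)
    have hother1 : ∀ j < e (!i) + n, w (!i) (t - 1) j = w' (!i) (t - 1) j := by
      intro j hj
      rcases Nat.eq_zero_or_pos t with rfl | ht
      · simp [hw, hw']
      exact (hK (t - 1) (by omega)).1 j hj
    have hother : ∀ j < r (!i), strongData e w t (!i) j = strongData e w' t (!i) j := by
      intro j hj
      have := hr (!i)
      unfold strongData
      split_ifs with hji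
      · by_cases ht : t ≤ 3
        · simp [show t - 3 = 0 by omega, hw, hw']
        exact (hK (t - 3) (by omega)).1 j (by omega)
      · exact hother1 j (by omega)
    unfold strongR
    split_ifs with hl
    · rw [hother1 _ (by omega), down_congr (strongRData_congr hother)]
    · exact strongRData_congr hown l
  dest := by
    intro i w w' T _ _ h t ht l hl
    have hf := haf i
    have hb := hab i
    have hnot : ¬ (b i ≤ a i + l ∧ a i + l < b i + e (!i)) := by omega
    by_cases hle : l < e i
    · simpa [strongR, hnot, strongRData, strongData, hle, hl] using
        h (t + 3) (by omega) (a i + l) (by omega)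
    · simpa [strongR, hnot, strongRData, strongData, hle, hl] using
        h (t + 1) (by omega) (a i + l) (by omega)

end Strong

/-! ### Moderate interference: no cooperation -/

section Moderate

open Module

/-- A subspace meeting `A` and `B` trivially extends to one of any dimension complementary to an
upper bound for the dimensions of `A` and `B`. -/
theorem exists_submodule_disjoint {K H : Type*} [Field K] [AddCommGroup H] [Module K H]
    [FiniteDimensional K H] {A B V₀ : Submodule K H} (hA : Disjoint V₀ A) (hB : Disjoint V₀ B)
    {d : ℕ} (hd : finrank K V₀ ≤ d) (hdA : finrank K A + d ≤ finrank K H)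
    (hdB : finrank K B + d ≤ finrank K H) :
    ∃ V, V₀ ≤ V ∧ finrank K V = d ∧ Disjoint V A ∧ Disjoint V B := by
  induction d, hd using Nat.le_induction with
  | base => exact ⟨V₀, le_rfl, rfl, hA, hB⟩
  | succ d hd ih =>
    obtain ⟨V, hV₀, hVd, hVA, hVB⟩ := ih (by omega) (by omega)
    have hne : ∀ {D : Submodule K H}, finrank K D + (d + 1) ≤ finrank K H →
        V ⊔ D ≠ ⊤ := by
      intro D hD htop
      have h1 := Submodule.finrank_add_le_finrank_add_finrank V D
      rw [htop, finrank_top] at h1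
      omega
    obtain ⟨x, hxA, hxB⟩ : ∃ x, x ∉ V ⊔ A ∧ x ∉ V ⊔ B := by
      by_contra! hcon
      obtain ⟨y, hy⟩ := SetLike.exists_not_mem_of_ne_top _ (hne hdA)
      obtain ⟨z, hz⟩ := SetLike.exists_not_mem_of_ne_top _ (hne hdB)
      have hyB := hcon y hy
      have hzA : z ∈ V ⊔ A := by
        by_contra h
        exact hz (hcon z h)
      by_cases hyz : y + z ∈ V ⊔ A
      · exact hy ((Submodule.add_mem_iff_left _ hzA).1 hyz)
      · exact hz ((Submodule.add_mem_iff_right _ hyB).1 (hcon _ hyz))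
    have hx0 : ∀ {D : Submodule K H}, Disjoint V D → x ∉ V ⊔ D → Disjoint (V ⊔ K ∙ x) D := by
      intro D hVD hxD
      rw [sup_comm]
      exact hVD.disjoint_sup_left_of_disjoint_sup_right
        ((Submodule.disjoint_span_singleton' (by rintro rfl; exact hxD (zero_mem _))).2 hxD).symm
    refine ⟨V ⊔ K ∙ x, hV₀.trans le_sup_left, ?_, hx0 hVA hxA, hx0 hVB hxB⟩
    have hxV : x ∉ V := fun h => hxA (Submodule.mem_sup_left h)
    have hxne : x ≠ 0 := by rintro rfl; exact hxV (zero_mem _)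
    have h1 := Submodule.finrank_sup_add_finrank_inf_eq V (K ∙ x)
    rw [((Submodule.disjoint_span_singleton' hxne).2 hxV).eq_bot, finrank_bot,
      finrank_span_singleton hxne] at h1
    omega

/-- Two embeddings `φ`, `ψ` of `G` in `H` have subspaces `U`, `V` of any dimensions allowed by
counting such that no nonzero element is sent into `U` by one of them and into `V` by the other. -/
theorem exists_submodule_avoiding {K G H : Type*} [Field K] [AddCommGroup G] [Module K G]
    [FiniteDimensional K G] [AddCommGroup H] [Module K H] [FiniteDimensional K H]
    {φ ψ : G →ₗ[K] H} (hφ : Function.Injective φ) (hψ : Function.Injective ψ) {a b : ℕ}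
    (haH : a ≤ finrank K H) (ha : finrank K H ≤ a + finrank K G)
    (hab : a + b + finrank K G ≤ 2 * finrank K H) :
    ∃ U V : Submodule K H, finrank K U = a ∧ finrank K V = b ∧
      (∀ s, φ s ∈ U → ψ s ∈ V → s = 0) ∧ (∀ s, ψ s ∈ U → φ s ∈ V → s = 0) := by
  have hφr : finrank K (LinearMap.range φ) = finrank K G := LinearMap.finrank_range_of_inj hφ
  have hψr : finrank K (LinearMap.range ψ) = finrank K G := LinearMap.finrank_range_of_inj hψ
  have hGH : finrank K G ≤ finrank K H := LinearMap.finrank_le_finrank_of_injective hφ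
  obtain ⟨U₀, -, hU₀, hUφ, hUψ⟩ := exists_submodule_disjoint (K := K) (V₀ := ⊥)
    (A := LinearMap.range φ) (B := LinearMap.range ψ) disjoint_bot_left disjoint_bot_left
    (d := finrank K H - finrank K G) (by simp) (by omega) (by omega)
  obtain ⟨U, hUU, hU, -, -⟩ := exists_submodule_disjoint (K := K) (V₀ := U₀) (A := ⊥) (B := ⊥)
    disjoint_bot_right disjoint_bot_right (d := a) (by omega) (by simpa) (by simpa)
  have hdim : ∀ (χ ξ : G →ₗ[K] H), Function.Injective χ → Disjoint U₀ (LinearMap.range χ) →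
      finrank K ((U.comap χ).map ξ) + b ≤ finrank K H := by
    intro χ ξ hχ hd
    have h1 : finrank K ((U.comap χ).map ξ) ≤ finrank K (U.comap χ) :=
      Submodule.finrank_map_le ξ _
    have h2 : finrank K ((U.comap χ).map χ) = finrank K (U.comap χ) :=
      (Submodule.equivMapOfInjective χ hχ _).finrank_eq.symm
    have h3 : Disjoint U₀ ((U.comap χ).map χ) := hd.mono_right LinearMap.map_le_range
    have h4 := Submodule.finrank_sup_add_finrank_inf_eq U₀ ((U.comap χ).map χ)
    rw [h3.eq_bot, finrank_bot] at h4
    have h5 := Submodule.finrank_mono (sup_le hUU (Submodule.map_comap_le χ U))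
    omega
  obtain ⟨V, -, hV, hVA, hVB⟩ := exists_submodule_disjoint (K := K) (V₀ := ⊥)
    (A := (U.comap φ).map ψ) (B := (U.comap ψ).map φ) disjoint_bot_left disjoint_bot_left
    (d := b) (by simp) (hdim φ ψ hφ hUφ) (hdim ψ φ hψ hUψ)
  refine ⟨U, V, hU, hV, fun s hs hs' => ?_, fun s hs hs' => ?_⟩
  · refine hψ (Eq.trans ?_ (map_zero ψ).symm)
    exact Submodule.disjoint_def.1 hVA _ hs' (Submodule.mem_map_of_mem hs)
  · refine hφ (Eq.trans ?_ (map_zero φ).symm)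
    exact Submodule.disjoint_def.1 hVB _ hs' (Submodule.mem_map_of_mem hs)

/-- Codes on `L` levels such that a receiver seeing the sum of one code word and the other one moved
down by `d` levels recovers both messages, whichever of the two is moved. -/
theorem exists_code_of_shifted_sum {L d : ℕ} (hd : d ≤ L) {R : Bool → ℕ} (hRL : R false ≤ L)
    (hRd : d ≤ R false) (hR : R false + R true ≤ L + d) :
    ∃ E : Bool → (ℕ → ZMod 2) → ℕ → ZMod 2, (∀ i x l, L ≤ l → E i x l = 0) ∧
      ∀ i x y x' y', (∀ l < L + d,
        E i x l + down d (E (!i) y) l = E i x' l + down d (E (!i) y') l) →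
        (∀ j < R i, x j = x' j) ∧ ∀ j < R (!i), y j = y' j := by
  let φ : (Fin (L - d) → ZMod 2) →ₗ[ZMod 2] (Fin L → ZMod 2) :=
    { toFun := fun s l => if h : d ≤ l then s ⟨l - d, by omega⟩ else 0
      map_add' := fun s s' => by ext l; by_cases h : d ≤ (l : ℕ) <;> simp [h]
      map_smul' := fun c s => by ext l; by_cases h : d ≤ (l : ℕ) <;> simp [h] }
  let ψ : (Fin (L - d) → ZMod 2) →ₗ[ZMod 2] (Fin L → ZMod 2) :=
    { toFun := fun s l => if h : (l : ℕ) < L - d then s ⟨l, h⟩ else 0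
      map_add' := fun s s' => by ext l; by_cases h : (l : ℕ) < L - d <;> simp [h]
      map_smul' := fun c s => by ext l; by_cases h : (l : ℕ) < L - d <;> simp [h] }
  have hφ : Function.Injective φ := by
    intro s s' h
    ext j
    simpa [φ] using congrFun h ⟨j + d, by omega⟩
  have hψ : Function.Injective ψ := by
    intro s s' h
    ext j
    simpa [ψ] using congrFun h ⟨j, by omega⟩
  obtain ⟨U₀, U₁, hU₀, hU₁, h01, h10⟩ := exists_submodule_avoiding hφ hψ (a := R false)
    (b := R true) (by simpa) (by simp; omega) (by simp; omega)
  let U : Bool → Submodule (ZMod 2) (Fin L → ZMod 2) := fun i => if i then U₁ else U₀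
  have hU : ∀ i, finrank (ZMod 2) (U i) = R i := by
    intro i
    cases i <;> simpa [U]
  have hav : ∀ i s, φ s ∈ U i → ψ s ∈ U (!i) → s = 0 := by
    intro i s h1 h2
    cases i
    · exact h01 s h1 h2
    · exact h10 s h2 h1
  let ℓ (i : Bool) : (Fin (R i) → ZMod 2) ≃ₗ[ZMod 2] U i :=
    LinearEquiv.ofFinrankEq _ _ (by simp [hU])
  let c (i : Bool) (x : ℕ → ZMod 2) : Fin L → ZMod 2 := ℓ i (topLevels (R i) x)
  have hc : ∀ i x x', c i x - c i x' = 0 → ∀ j < R i, x j = x' j := by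
    intro i x x' h
    exact topLevels_eq_iff.1 ((ℓ i).injective (Subtype.ext (sub_eq_zero.1 h)))
  refine ⟨fun i x l => if h : l < L then c i x ⟨l, h⟩ else 0,
    fun i x l hl => dif_neg (by omega), fun i x y x' y' h => ?_⟩
  set u := c i x' - c i x with hu
  set v := c (!i) y - c (!i) y' with hv
  have hu' : u ∈ U i := sub_mem (ℓ i _).2 (ℓ i _).2
  have hv' : v ∈ U (!i) := sub_mem (ℓ (!i) _).2 (ℓ (!i) _).2
  let s : Fin (L - d) → ZMod 2 := fun j => v ⟨j, by omega⟩
  have hvs : ψ s = v := by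
    ext l
    by_cases hl : (l : ℕ) < L - d
    · simp [ψ, s, hl]
    · have := h (l + d) (by omega)
      have hl' : ¬ (l : ℕ) + d < L := by omega
      simp only [down, hl', dif_neg, not_false_eq_true, zero_add, le_add_iff_nonneg_left,
        Nat.zero_le, if_true, Nat.add_sub_cancel, l.2, dif_pos, Fin.eta] at this
      simp [ψ, hl, hv, this]
  have hus : φ s = u := by
    ext l
    have := h l (by omega)
    by_cases hl : d ≤ (l : ℕ)
    · have hl' : (l : ℕ) - d < L := by omega
      simp only [down, l.2, hl, hl', dif_pos, if_true, Fin.eta] at this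
      simp only [φ, s, hl, hu, hv, LinearMap.coe_mk, AddHom.coe_mk, dif_pos, Pi.sub_apply]
      linear_combination this
    · simp only [down, l.2, hl, dif_pos, if_false, Fin.eta, add_zero] at this
      simp [φ, hl, hu, this]
  have hs : s = 0 := hav i s (hus ▸ hu') (hvs ▸ hv')
  rw [hs, map_zero] at hvs hus
  exact ⟨fun j hj => (hc i x' x hus.symm j hj).symm, hc (!i) y y' hvs.symm⟩

variable {n m f nb mb : ℕ} {r : Bool → ℕ}

/-- If a pair of one-slot encoders lets both relays decode, then the relays may decode and
forward. -/
theorem isScheme_decodeForward {E : Bool → (ℕ → ZMod 2) → ℕ → ZMod 2} (hrf : ∀ i, r i ≤ f)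
    (hE : ∀ i (x x' : Bool → ℕ → ZMod 2), (∀ l < max m n,
      hearR n m (fun i => E i (x i)) i l = hearR n m (fun i => E i (x' i)) i l) →
      ∀ j < r i, x i j = x' i j) :
    IsScheme n m f nb mb r (fun w t i => E i (w i t))
      (fun w t i l => if l < r i then w i (t - 1) l else 0) where
  source := by
    intro i w w' t _ _ hi _ l _
    rw [hi]
  relay := by
    intro i w w' t hw hw' h l _
    split_ifs with hl
    · rcases Nat.eq_zero_or_pos t with rfl | ht
      · simp [hw, hw']
      exact hE i (fun i => w i (t - 1)) (fun i => w' i (t - 1)) (h (t - 1) (by omega)) l hl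
    · rfl
  dest := by
    intro i w w' T _ _ h t ht l hl
    simpa [hl] using h (t + 1) (by omega) l (hl.trans_le (hrf i))

theorem exists_scheme_of_le_of_le_two_mul (hnm : n ≤ m) (hm : m ≤ 2 * n) (hrf : ∀ i, r i ≤ f)
    (hr0 : r false ≤ (m + 1) / 2) (hr1 : r true ≤ m / 2) :
    ∃ XS XR, IsScheme n m f nb mb r XS XR := by
  let R : Bool → ℕ := fun i => if i then m / 2 else (m + 1) / 2
  have hrR : ∀ i, r i ≤ R i := by
    intro i
    cases i <;> simpa [R]
  obtain ⟨E, -, hE⟩ := exists_code_of_shifted_sum (L := n) (d := m - n) (R := R) (by omega)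
    (by simp [R]; omega) (by simp [R]; omega) (by simp [R]; omega)
  refine ⟨_, _, isScheme_decodeForward (E := E) hrf fun i x x' h j hj => ?_⟩
  rw [max_eq_left hnm] at h
  have := (hE (!i) (x (!i)) (x (!!i)) (x' (!i)) (x' (!!i)) fun l hl => ?_).2
  · simpa using this j (by simpa using hj.trans_le (hrR i))
  · have := h l (by omega)
    rw [hearR_of_ge hnm, hearR_of_ge hnm] at this
    simpa [add_comm] using this

theorem exists_scheme_of_ge_of_two_mul_le (hmn : m ≤ n) (hm : 2 * n ≤ 3 * m) (hrf : ∀ i, r i ≤ f)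
    (hr0 : r false ≤ (m + 1) / 2 + (n - m)) (hr1 : r true ≤ m / 2 + (n - m)) :
    ∃ XS XR, IsScheme n m f nb mb r XS XR := by
  let R : Bool → ℕ := fun i => if i then m / 2 else (m + 1) / 2
  have hrR : ∀ i, r i ≤ R i + (n - m) := by
    intro i
    cases i <;> simpa [R]
  obtain ⟨E, hE0, hE⟩ := exists_code_of_shifted_sum (L := 2 * m - n) (d := n - m) (R := R)
    (by omega) (by simp [R]; omega) (by simp [R]; omega) (by simp [R]; omega)
  let E' : Bool → (ℕ → ZMod 2) → ℕ → ZMod 2 := fun i x l =>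
    if m ≤ l then x (R i + (l - m)) else E i x l
  refine ⟨_, _, isScheme_decodeForward (E := E') hrf fun i x x' h j hj => ?_⟩
  rw [max_eq_right hmn] at h
  simp only [hearR_of_le hmn] at h
  have hrj := hrR i
  by_cases hjR : j < R i
  · refine (hE i (x i) (x (!i)) (x' i) (x' (!i)) fun l hl => ?_).1 j hjR
    simpa [E', down, show ¬ m ≤ l by omega, show ¬ m ≤ l - (n - m) by omega] using h l (by omega)
  · have h0 : ∀ x : ℕ → ZMod 2, down (n - m) (E' (!i) x) (m + (j - R i)) = 0 := by
      intro x
      simp [down, E', show ¬ m ≤ m + (j - R i) - (n - m) by omega, hE0 (!i) x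
        (m + (j - R i) - (n - m)) (by omega)]
    have := h (m + (j - R i)) (by omega)
    rw [h0, h0] at this
    simpa [E', show R i + (j - R i) = j by omega] using this

end Moderate

end TwoHopIC

open TwoHopIC in
/-- Inner bound (Theorem 2). -/
theorem inner_bound (n m f nb mb : ℕ) :
    (3 * m ≤ 2 * n →
      min (2 * max ((n : ℝ) - m) m + 2 * mb) (min (2 * (n : ℝ) - m) (2 * f)) ≤
        sumCapacity n m f nb mb) ∧
    (2 * n ≤ 3 * m → m ≤ 2 * n →
      min (max (2 * (n : ℝ) - m) (m : ℝ)) (2 * f) ≤ sumCapacity n m f nb mb) ∧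
    (2 * n ≤ m →
      min ((n : ℝ) + f + max ((nb : ℝ) - f) 0)
          (min (2 * (n : ℝ) + 2 * nb) (min (m : ℝ) (2 * f))) ≤
        sumCapacity n m f nb mb) := by
  refine ⟨fun hm => ?_, fun hm hm' => ?_, fun hm => ?_⟩
  · obtain ⟨g, hg⟩ : ∃ g, g = max (n - m) m := ⟨_, rfl⟩
    obtain ⟨V, hV⟩ : ∃ V, V = min (2 * g + 2 * mb) (min (2 * n - m) (2 * f)) := ⟨_, rfl⟩
    let r : Bool → ℕ := fun i => if i then V / 2 else (V + 1) / 2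
    let e : Bool → ℕ := fun i => r i - g
    have h := isScheme_weak (n := n) (m := m) (f := f) (nb := nb) (mb := mb) (k := 2 * m - n)
      (e := e) (r := r) (by omega) (by omega) (by omega) (by simp [e, r]; omega)
      (by intro i; cases i <;> simp [e, r] <;> omega)
      (by intro i; cases i <;> simp [e, r])
      (by intro i; cases i <;> simp [e, r] <;> omega)
      (by intro i; cases i <;> simp [r] <;> omega)
    convert h.le_sumCapacity using 1
    rw [show r false + r true = V by simp [r]; omega, hV, hg]
    push_cast [Nat.cast_sub (show m ≤ n by omega), Nat.cast_sub (show m ≤ 2 * n by omega)]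
    rfl
  · obtain ⟨V, hV⟩ : ∃ V, V = min (max (2 * n - m) m) (2 * f) := ⟨_, rfl⟩
    let r : Bool → ℕ := fun i => if i then V / 2 else (V + 1) / 2
    obtain ⟨XS, XR, h⟩ : ∃ XS XR, IsScheme n m f nb mb r XS XR := by
      rcases le_total n m with hnm | hmn
      · exact exists_scheme_of_le_of_le_two_mul hnm hm'
          (by intro i; cases i <;> simp [r] <;> omega) (by simp [r]; omega) (by simp [r]; omega)
      · exact exists_scheme_of_ge_of_two_mul_le hmn hm
          (by intro i; cases i <;> simp [r] <;> omega) (by simp [r]; omega) (by simp [r]; omega)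
    convert h.le_sumCapacity using 1
    rw [show r false + r true = V by simp [r]; omega, hV]
    push_cast [Nat.cast_sub hm']
    rfl
  · obtain ⟨V, hV⟩ : ∃ V, V = min (n + max f nb) (min (2 * n + 2 * nb) (min m (2 * f))) :=
      ⟨_, rfl⟩
    let r : Bool → ℕ := fun i => if i then V / 2 else (V + 1) / 2
    let e : Bool → ℕ := fun i => r i - n
    let a : Bool → ℕ := fun i => if f ≤ nb then 0 else e (!i)
    let b : Bool → ℕ := fun i => if f ≤ nb then r i else 0
    have h := isScheme_strong (n := n) (m := m) (f := f) (nb := nb) (mb := mb) (a := a) (b := b)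
      (e := e) (r := r) (by simp [e, r]; omega)
      (by intro i; by_cases hf : f ≤ nb <;> cases i <;> simp [b, e, r, hf] <;> omega)
      (by intro i; by_cases hf : f ≤ nb <;> cases i <;> simp [a, e, r, hf] <;> omega)
      (by intro i; by_cases hf : f ≤ nb <;> cases i <;> simp [a, b, e, r, hf])
      (by intro i; cases i <;> simp [e, r] <;> omega)
    convert h.le_sumCapacity using 1
    rw [show r false + r true = V by simp [r]; omega, hV]
    push_cast
    rw [add_assoc, ← max_add_add_left, add_sub_cancel, add_zero, max_comm (nb : ℝ)]
end
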